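/- Let K be a valued field whose value group has a least positive element, regarded as an L_VR-structure, elementarily equivalent to ℂ((t)). Let X ⊆ O_K be a subset definable by an L_VR-formula with parameters from K such that res(X) is infinite (X is res-cofinite), and let K₀ be an elementary L_VR-substructure of K. Then X ∩ K₀ ≠ ∅. -/

import Mathlib

open FirstOrder

/-- The function symbols of the language `L_VR`: the ring language `{0, 1, +, ×}`. -/
inductive LVRFunc : ℕ → Type
  | zero : LVRFunc 0
  | one : LVRFunc 0
  | add : LVRFunc 2
  | mul : LVRFunc 2

/-- The relation symbols of the language `L_VR`: a binary divisibility relation `|`,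
a unary relation `N`, and a unary relation `P_n` for each `n ≥ 1`. -/
inductive LVRRel : ℕ → Type
  | dvd : LVRRel 2
  | N : LVRRel 1
  | pow : ℕ+ → LVRRel 1

/-- The first-order language `L_VR` of valuation rings. -/
def LVR : FirstOrder.Language where
  Functions := LVRFunc
  Relations := LVRRel

/-- Interpretation of the `L_VR` function symbols in a field. -/
def LVRfun (K : Type*) [Field K] : ∀ {n : ℕ}, LVRFunc n → (Fin n → K) → K
  | _, .zero => fun _ => 0
  | _, .one => fun _ => 1
  | _, .add => fun x => x 0 + x 1
  | _, .mul => fun x => x 0 * x 1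

/-- Interpretation of the `L_VR` relation symbols in a valued field (Mathlib's
multiplicative convention for valuations is order-reversing w.r.t. the additive
convention of the paper: `x | y` means `v_add(x) ≤ v_add(y)`, i.e. multiplicatively
`v (x 1) ≤ v (x 0)`; `N x` means `v_add(x) = 1_Γ`, where `γ₁` is the multiplicative
avatar of the least positive element of the value group; `P_n x` means `x` is an
`n`-th power). -/
def LVRrel {K : Type*} [Field K] {Γ₀ : Type*} [LinearOrderedCommGroupWithZero Γ₀]
    (v : Valuation K Γ₀) (γ₁ : Γ₀) : ∀ {n : ℕ}, LVRRel n → (Fin n → K) → Prop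
  | _, .dvd => fun x => v (x 1) ≤ v (x 0)
  | _, .N => fun x => v (x 0) = γ₁
  | _, .pow m => fun x => ∃ y : K, x 0 = y ^ (m : ℕ)

/-- A valued field, together with the (multiplicative avatar of the) least positive
element of its value group, as an `L_VR`-structure. -/
def valuedStructure {K : Type*} [Field K] {Γ₀ : Type*} [LinearOrderedCommGroupWithZero Γ₀]
    (v : Valuation K Γ₀) (γ₁ : Γ₀) : LVR.Structure K where
  funMap := LVRfun K
  RelMap := LVRrel v γ₁

/-- `γ₁` is the multiplicative avatar of the least positive element of the value
group: the greatest element of `Γ₀ ∖ {0}` that is `< 1`. -/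
def IsLeastPos {Γ₀ : Type*} [LinearOrderedCommGroupWithZero Γ₀] (γ₁ : Γ₀) : Prop :=
  γ₁ ≠ 0 ∧ γ₁ < 1 ∧ ∀ δ : Γ₀, δ ≠ 0 → δ < 1 → δ ≤ γ₁

/-- `ℂ((t))`, the field of formal Laurent series over `ℂ` with its `t`-adic
valuation, as an `L_VR`-structure. -/
noncomputable def laurentStructure : LVR.Structure (LaurentSeries ℂ) :=
  valuedStructure (Valued.v : Valuation (LaurentSeries ℂ) (WithZero (Multiplicative ℤ)))
    ((Multiplicative.ofAdd (-1 : ℤ) : Multiplicative ℤ) : WithZero (Multiplicative ℤ))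

open Polynomial Filter

universe u

/-- The first-order properties of `ℂ((t))` used in the back-and-forth argument. -/
structure LaurentLike {F : Type*} [Field F] {Γ : Type*} [LinearOrderedCommGroupWithZero Γ]
    (w : Valuation F Γ) (γ : Γ) : Prop where
  nat : ∀ n : ℕ, n ≠ 0 → w (n : F) = 1
  hensel : ∀ p : F[X], (∀ k, w (p.coeff k) ≤ 1) → ∀ x, w x ≤ 1 → w (p.eval x) < 1 →
    w (p.derivative.eval x) = 1 → ∃ r, p.eval r = 0 ∧ w (r - x) < 1
  resAlg : ∀ p : F[X], p.Monic → p.natDegree ≠ 0 → (∀ k, w (p.coeff k) ≤ 1) →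
    ∃ x, w x ≤ 1 ∧ w (p.eval x) < 1
  zgrp : ∀ n : ℕ, n ≠ 0 → ∀ x t : F, w t = γ → ∃ j : ℕ, j < n ∧ ∃ z, w x = w t ^ j * w z ^ n
  exists_unif : ∃ t, w t = γ
  ne_zero : γ ≠ 0
  lt_one : γ < 1
  le_of_lt_one : ∀ x, w x < 1 → w x ≤ γ

section

variable {F : Type u} [Field F] {Γ : Type*} [LinearOrderedCommGroupWithZero Γ]

/-- The value of `x` is an `n`-th power in the value group. -/
def IsPowVal (w : Valuation F Γ) (n : ℕ) (x : F) : Prop := ∃ z, w x = w z ^ n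

theorem IsPowVal.congr {w : Valuation F Γ} {n : ℕ} {x y : F} (h : w x = w y) :
    IsPowVal w n x ↔ IsPowVal w n y := by
  simp [IsPowVal, h]

theorem IsPowVal.mul_pow_iff {w : Valuation F Γ} {n : ℕ} {x y : F} (hy : y ≠ 0) :
    IsPowVal w n (x * y ^ n) ↔ IsPowVal w n x := by
  have hy' : w y ≠ 0 := (Valuation.ne_zero_iff _).2 hy
  constructor
  · rintro ⟨z, hz⟩
    refine ⟨z / y, ?_⟩
    rw [map_mul, map_pow] at hz
    rw [map_div₀, div_pow, ← hz, mul_div_cancel_right₀ _ (pow_ne_zero _ hy')]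
  · rintro ⟨z, hz⟩
    exact ⟨z * y, by simp [hz, mul_pow]⟩

/-- A countable partial isomorphism of the valued field `F`, viewed as a subring of `F × F`. -/
structure IsPartialIso (w : Valuation F Γ) (γ : Γ) (G : Subring (F × F)) : Prop where
  inv_mem : ∀ p ∈ G, (p.1⁻¹, p.2⁻¹) ∈ G
  le_iff : ∀ p ∈ G, ∀ q ∈ G, w p.1 ≤ w q.1 ↔ w p.2 ≤ w q.2
  pow_iff : ∀ p ∈ G, ∀ n : ℕ, 0 < n → (IsPowVal w n p.1 ↔ IsPowVal w n p.2)
  unif : ∃ t ∈ G, w t.1 = γ ∧ w t.2 = γ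
  countable : (G : Set (F × F)).Countable

/-- Two embeddings of a field `E` inducing the same valuation structure. -/
structure SameVal {E : Type*} [Field E] (w : Valuation F Γ) (γ : Γ) (i j : E →+* F) : Prop where
  le_iff : ∀ a b : E, w (i a) ≤ w (i b) ↔ w (j a) ≤ w (j b)
  pow_iff : ∀ (a : E) (n : ℕ), 0 < n → (IsPowVal w n (i a) ↔ IsPowVal w n (j a))
  unif : ∃ t : E, w (i t) = γ ∧ w (j t) = γ

/-- Adjoining `x` and `x'` respectively yields the same valuation structure. -/
structure Compat {E : Type*} [Field E] (w : Valuation F Γ) (i j : E →+* F) (x x' : F) : Prop where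
  le_iff : ∀ g h : E[X],
    w (g.eval₂ i x) ≤ w (h.eval₂ i x) ↔ w (g.eval₂ j x') ≤ w (h.eval₂ j x')
  pow_iff : ∀ (g : E[X]) (n : ℕ), 0 < n →
    (IsPowVal w n (g.eval₂ i x) ↔ IsPowVal w n (g.eval₂ j x'))

variable {w : Valuation F Γ} {γ : Γ}

theorem IsPartialIso.exists_sameVal {G : Subring (F × F)} (hG : IsPartialIso w γ G) :
    ∃ (E : Type u) (_ : Field E) (_ : Countable E) (i j : E →+* F),
      SameVal w γ i j ∧ ∀ p, p ∈ G ↔ ∃ e, i e = p.1 ∧ j e = p.2 := by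
  have hfield : IsField G := by
    refine ⟨⟨0, 1, fun h => ?_⟩, mul_comm, ?_⟩
    · have := congrArg (fun a : G => (a : F × F).1) h
      simp at this
    · rintro ⟨p, hp⟩ hne
      have h1 : p.1 = 0 ↔ p.2 = 0 := by
        have := hG.le_iff p hp 0 G.zero_mem
        simpa using this
      have h2 : p.1 ≠ 0 := by
        intro h0
        exact hne (Subtype.ext (Prod.ext h0 (h1.1 h0)))
      have h3 : p.2 ≠ 0 := fun h => h2 (h1.2 h)
      refine ⟨⟨_, hG.inv_mem p hp⟩, Subtype.ext (Prod.ext ?_ ?_)⟩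
      · exact mul_inv_cancel₀ h2
      · exact mul_inv_cancel₀ h3
  let i : G →+* F := (RingHom.fst F F).comp G.subtype
  let j : G →+* F := (RingHom.snd F F).comp G.subtype
  let _ : Field G := hfield.toField
  refine ⟨G, inferInstance, hG.countable.to_subtype, i, j,
    ⟨fun a b => hG.le_iff a a.2 b b.2, fun a n hn => hG.pow_iff a a.2 n hn, ?_⟩, ?_⟩
  · obtain ⟨t, ht, h⟩ := hG.unif
    exact ⟨⟨t, ht⟩, h⟩
  · intro p
    constructor
    · intro hp
      exact ⟨⟨p, hp⟩, rfl, rfl⟩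
    · rintro ⟨e, h1, h2⟩
      have : (e : F × F) = p := Prod.ext h1 h2
      rw [← this]
      exact e.2

theorem IsPartialIso.swap {G : Subring (F × F)} (hG : IsPartialIso w γ G) :
    IsPartialIso w γ (G.comap (RingEquiv.prodComm : F × F ≃+* F × F).toRingHom) := by
  refine ⟨fun p hp => ?_, fun p hp q hq => ?_, fun p hp n hn => ?_, ?_, ?_⟩
  · exact hG.inv_mem _ hp
  · exact (hG.le_iff _ hp _ hq).symm
  · exact (hG.pow_iff _ hp n hn).symm
  · obtain ⟨t, ht, h⟩ := hG.unif
    exact ⟨t.swap, ht, h.symm⟩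
  · exact hG.countable.preimage (RingEquiv.prodComm : F × F ≃+* F × F).injective

theorem SameVal.eq_iff {E : Type*} [Field E] {i j : E →+* F} (h : SameVal w γ i j) (a b : E) :
    w (i a) = w (i b) ↔ w (j a) = w (j b) := by
  simp only [le_antisymm_iff, h.le_iff]

theorem SameVal.lt_iff {E : Type*} [Field E] {i j : E →+* F} (h : SameVal w γ i j) (a b : E) :
    w (i a) < w (i b) ↔ w (j a) < w (j b) := by
  simp only [← not_le, h.le_iff]

theorem SameVal.isEquiv {E : Type*} [Field E] {i j : E →+* F} (h : SameVal w γ i j) :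
    (w.comap i).IsEquiv (w.comap j) := fun a b => h.le_iff a b

theorem Compat.exists_partialIso {E : Type*} [Field E] [Countable E] {i j : E →+* F}
    (h : SameVal w γ i j) {x x' : F} (hc : Compat w i j x x') :
    ∃ G : Subring (F × F), IsPartialIso w γ G ∧ (∀ e, (i e, j e) ∈ G) ∧ (x, x') ∈ G ∧
      ∀ p ∈ G, ∃ g k : E[X], p.1 = g.eval₂ i x / k.eval₂ i x := by
  have hz : ∀ g : E[X], g.eval₂ i x = 0 ↔ g.eval₂ j x' = 0 := fun g => by
    simpa using hc.le_iff g 0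
  let f : E[X] × E[X] → F × F := fun q =>
    (q.1.eval₂ i x / q.2.eval₂ i x, q.1.eval₂ j x' / q.2.eval₂ j x')
  let G : Subring (F × F) :=
    { carrier := {p | ∃ g k : E[X], k.eval₂ i x ≠ 0 ∧ p = f (g, k)}
      zero_mem' := ⟨0, 1, by simp, by simp [f]; rfl⟩
      one_mem' := ⟨1, 1, by simp, by simp [f]; rfl⟩
      add_mem' := by
        rintro _ _ ⟨g, k, hk, rfl⟩ ⟨g', k', hk', rfl⟩
        have hk2 := (hz k).not.1 hk
        have hk2' := (hz k').not.1 hk'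
        refine ⟨g * k' + k * g', k * k', by simp [eval₂_mul, hk, hk'], ?_⟩
        simp only [f, eval₂_add, eval₂_mul, Prod.mk_add_mk]
        rw [div_add_div _ _ hk hk', div_add_div _ _ hk2 hk2']
      mul_mem' := by
        rintro _ _ ⟨g, k, hk, rfl⟩ ⟨g', k', hk', rfl⟩
        refine ⟨g * g', k * k', by simp [eval₂_mul, hk, hk'], ?_⟩
        simp only [f, eval₂_mul, Prod.mk_mul_mk, div_mul_div_comm]
      neg_mem' := by
        rintro _ ⟨g, k, hk, rfl⟩
        exact ⟨-g, k, hk, by simp [f, neg_div]⟩ }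
  have hmem : ∀ p, p ∈ G ↔ ∃ g k : E[X], k.eval₂ i x ≠ 0 ∧ p = f (g, k) := fun p => Iff.rfl
  have hval : ∀ k : E[X], k.eval₂ i x ≠ 0 → 0 < w (k.eval₂ i x) ∧ 0 < w (k.eval₂ j x') :=
    fun k hk => ⟨zero_lt_iff.2 ((Valuation.ne_zero_iff _).2 hk),
      zero_lt_iff.2 ((Valuation.ne_zero_iff _).2 ((hz k).not.1 hk))⟩
  refine ⟨G, ⟨?_, ?_, ?_, ?_, ?_⟩, ?_, ?_, ?_⟩
  · rintro _ ⟨g, k, hk, rfl⟩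
    by_cases hg : g.eval₂ i x = 0
    · refine ⟨0, 1, by simp, ?_⟩
      simp [f, hg, (hz g).1 hg]
    · exact ⟨k, g, hg, by simp [f]⟩
  · rintro _ ⟨g, k, hk, rfl⟩ _ ⟨g', k', hk', rfl⟩
    have := hc.le_iff (g * k') (g' * k)
    simp only [eval₂_mul, map_mul] at this
    simp only [f, map_div₀]
    rw [div_le_div_iff₀ (hval k hk).1 (hval k' hk').1, div_le_div_iff₀ (hval k hk).2 (hval k' hk').2]
    exact this
  · rintro _ ⟨g, k, hk, rfl⟩ n hn
    have := hc.pow_iff (g * k ^ (n - 1)) n hn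
    have key : ∀ a b : F, b ≠ 0 → a / b * b ^ n = a * b ^ (n - 1) := by
      intro a b hb
      obtain ⟨m, rfl⟩ := Nat.exists_eq_succ_of_ne_zero hn.ne'
      simp only [Nat.succ_eq_add_one, Nat.add_sub_cancel, pow_succ]
      field_simp
    simp only [eval₂_mul, eval₂_pow] at this
    have hk2 := (hz k).not.1 hk
    rw [← key _ _ hk, ← key _ _ hk2, IsPowVal.mul_pow_iff hk, IsPowVal.mul_pow_iff hk2] at this
    exact this
  · obtain ⟨t, ht⟩ := h.unif
    exact ⟨_, ⟨C t, 1, by simp, rfl⟩, by simpa [f] using ht⟩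
  · have : Countable E[X] := by
      rw [← Cardinal.mk_le_aleph0_iff]
      refine Polynomial.cardinalMk_le_max.trans (max_le ?_ le_rfl)
      exact Cardinal.mk_le_aleph0_iff.2 inferInstance
    refine (Set.countable_range f).mono ?_
    rintro _ ⟨g, k, hk, rfl⟩
    exact ⟨_, rfl⟩
  · intro e
    exact ⟨C e, 1, by simp, by simp [f]⟩
  · exact ⟨X, 1, by simp, by simp [f]⟩
  · rintro _ ⟨g, k, hk, rfl⟩
    exact ⟨g, k, rfl⟩

/-- If the values of polynomials at `x` and `x'` are determined by the same elements of `E`, the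
pair `x, x'` is compatible. -/
theorem Compat.of_eq {E : Type*} [Field E] {i j : E →+* F}
    (h : SameVal w γ i j) {x x' : F}
    (hx : ∀ g : E[X], ∃ c : E, w (g.eval₂ i x) = w (i c) ∧ w (g.eval₂ j x') = w (j c)) :
    Compat w i j x x' := by
  refine ⟨fun g k => ?_, fun g n hn => ?_⟩
  · obtain ⟨c, h1, h2⟩ := hx g
    obtain ⟨d, h3, h4⟩ := hx k
    rw [h1, h2, h3, h4, h.le_iff]
  · obtain ⟨c, h1, h2⟩ := hx g
    rw [IsPowVal.congr h1, IsPowVal.congr h2, h.pow_iff c n hn]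

theorem Compat.of_monomial {E : Type*} [Field E] {i j : E →+* F} {x x' : F}
    (hle : ∀ (a b : E) (m n : ℕ), w (i a * x ^ m) ≤ w (i b * x ^ n) ↔
      w (j a * x' ^ m) ≤ w (j b * x' ^ n))
    (hpow : ∀ (a : E) (m n : ℕ), 0 < n →
      (IsPowVal w n (i a * x ^ m) ↔ IsPowVal w n (j a * x' ^ m)))
    (hx : ∀ g : E[X], ∃ (c : E) (m : ℕ), w (g.eval₂ i x) = w (i c * x ^ m) ∧
      w (g.eval₂ j x') = w (j c * x' ^ m)) :
    Compat w i j x x' := by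
  refine ⟨fun g k => ?_, fun g n hn => ?_⟩
  · obtain ⟨c, m, h1, h2⟩ := hx g
    obtain ⟨d, m', h3, h4⟩ := hx k
    rw [h1, h2, h3, h4, hle]
  · obtain ⟨c, m, h1, h2⟩ := hx g
    rw [IsPowVal.congr h1, IsPowVal.congr h2, hpow c m n hn]

/-- No proper algebraic extension of the pair of embeddings `i, j` exists inside `F`. -/
def AlgMaximal {E : Type*} [Field E] (w : Valuation F Γ) (i j : E →+* F) : Prop :=
  ∀ x x' : F, (∃ g : E[X], g ≠ 0 ∧ g.eval₂ i x = 0) → Compat w i j x x' → x ∈ Set.range i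

end

section

variable {F : Type u} [Field F] {Γ : Type*} [LinearOrderedCommGroupWithZero Γ]
variable {w : Valuation F Γ} {γ : Γ}

theorem IsPartialIso.fst_injOn {G : Subring (F × F)} (hG : IsPartialIso w γ G) :
    Set.InjOn Prod.fst (G : Set (F × F)) := by
  intro p hp q hq h
  have := hG.le_iff (p - q) (G.sub_mem hp hq) 0 G.zero_mem
  have h1 : p.1 - q.1 = 0 := sub_eq_zero.2 h
  refine Prod.ext h ?_
  simpa [h1, sub_eq_zero] using this

/-- Every countable partial isomorphism extends to an algebraically maximal one. -/
theorem IsPartialIso.exists_algMaximal {G : Subring (F × F)} (hG : IsPartialIso w γ G) :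
    ∃ (E : Type u) (_ : Field E) (_ : Countable E) (i j : E →+* F),
      SameVal w γ i j ∧ AlgMaximal w i j ∧ ∀ p ∈ G, ∃ e, i e = p.1 ∧ j e = p.2 := by
  obtain ⟨E₀, _, _, i₀, j₀, h₀, hG₀⟩ := hG.exists_sameVal
  let _ : Algebra E₀ F := i₀.toAlgebra
  let A : IntermediateField E₀ F := algebraicClosure E₀ F
  have hAc : (A : Set F).Countable := by
    refine (Algebraic.countable E₀ F).mono fun x hx => ?_
    exact mem_algebraicClosure_iff.1 hx
  obtain ⟨M, hGM, hM⟩ := zorn_le_nonempty₀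
    {H : Subring (F × F) | IsPartialIso w γ H ∧ ∀ p ∈ H, p.1 ∈ A} (by
      intro c hc hchain H₀ hH₀
      have hmem : ∀ {p}, p ∈ sSup c ↔ ∃ H ∈ c, p ∈ H :=
        Subring.mem_sSup_of_directedOn ⟨H₀, hH₀⟩ hchain.directedOn
      have hmem2 : ∀ p ∈ sSup c, ∀ q ∈ sSup c, ∃ H ∈ c, p ∈ H ∧ q ∈ H := by
        intro p hp q hq
        obtain ⟨H, hH, hpH⟩ := hmem.1 hp
        obtain ⟨H', hH', hqH'⟩ := hmem.1 hq
        rcases hchain.total hH hH' with h | h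
        · exact ⟨H', hH', h hpH, hqH'⟩
        · exact ⟨H, hH, hpH, h hqH'⟩
      refine ⟨sSup c, ⟨?_, ?_⟩, fun z hz => le_sSup hz⟩
      · have hle : ∀ p ∈ sSup c, ∀ q ∈ sSup c, w p.1 ≤ w q.1 ↔ w p.2 ≤ w q.2 := by
          intro p hp q hq
          obtain ⟨H, hH, hpH, hqH⟩ := hmem2 p hp q hq
          exact (hc hH).1.le_iff p hpH q hqH
        refine ⟨fun p hp => ?_, hle, fun p hp => ?_, ?_, ?_⟩
        · obtain ⟨H, hH, hpH⟩ := hmem.1 hp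
          exact hmem.2 ⟨H, hH, (hc hH).1.inv_mem p hpH⟩
        · obtain ⟨H, hH, hpH⟩ := hmem.1 hp
          exact (hc hH).1.pow_iff p hpH
        · obtain ⟨t, ht, h⟩ := (hc hH₀).1.unif
          exact ⟨t, hmem.2 ⟨H₀, hH₀, ht⟩, h⟩
        · refine Set.MapsTo.countable_of_injOn (f := Prod.fst) (t := (A : Set F)) ?_ ?_ hAc
          · intro p hp
            obtain ⟨H, hH, hpH⟩ := hmem.1 hp
            exact (hc hH).2 p hpH
          · intro p hp q hq h
            obtain ⟨H, hH, hpH, hqH⟩ := hmem2 p hp q hq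
            exact (hc hH).1.fst_injOn hpH hqH h
      · intro p hp
        obtain ⟨H, hH, hpH⟩ := hmem.1 hp
        exact (hc hH).2 p hpH) G ⟨hG, fun p hp => by
          obtain ⟨e, he, -⟩ := (hG₀ p).1 hp
          rw [← he]
          exact A.algebraMap_mem e⟩
  obtain ⟨E, _, _, i, j, hS, hMem⟩ := hM.prop.1.exists_sameVal
  refine ⟨E, inferInstance, inferInstance, i, j, hS, ?_, fun p hp => (hMem p).1 (hGM hp)⟩
  rintro x x' ⟨g, hg, hgx⟩ hcompat
  obtain ⟨H, hH, hEH, hxH, hfrac⟩ := hcompat.exists_partialIso hS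
  have hiA : ∀ e, i e ∈ A := fun e => hM.prop.2 _ ((hMem (i e, j e)).2 ⟨e, rfl, rfl⟩)
  have hxA : x ∈ A := by
    let i' : E →+* A := i.codRestrict A hiA
    have : IsAlgebraic A x := by
      refine ⟨g.map i', (Polynomial.map_ne_zero_iff i'.injective).2 hg, ?_⟩
      rw [aeval_def, eval₂_map]
      exact hgx
    have h2 : IsAlgebraic E₀ x := this.restrictScalars E₀
    exact mem_algebraicClosure_iff.2 h2
  have hpolyA : ∀ g : E[X], g.eval₂ i x ∈ A := by
    intro g
    rw [eval₂_eq_sum]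
    exact sum_mem fun n _ => mul_mem (hiA _) (pow_mem hxA _)
  have hHM : H ≤ M := by
    refine hM.le_of_ge ⟨hH, fun p hp => ?_⟩ fun p hp => ?_
    · obtain ⟨g, k, h⟩ := hfrac p hp
      rw [h]
      exact div_mem (hpolyA g) (hpolyA k)
    · obtain ⟨e, h1, h2⟩ := (hMem p).1 hp
      have := hEH e
      rwa [h1, h2] at this
  obtain ⟨e, he, -⟩ := (hMem _).1 (hHM hxH)
  exact ⟨e, he⟩

end

section

variable {F : Type*} [Field F] {Γ : Type*} [LinearOrderedCommGroupWithZero Γ]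
variable {w : Valuation F Γ} {γ : Γ}

theorem Valuation.eval₂_le_one {E : Type*} [Field E] {i : E →+* F} {p : E[X]}
    (hp : ∀ k, w (i (p.coeff k)) ≤ 1) {x : F} (hx : w x ≤ 1) : w (p.eval₂ i x) ≤ 1 := by
  rw [eval₂_eq_sum]
  refine w.map_sum_le fun n _ => ?_
  rw [map_mul, map_pow]
  exact mul_le_one' (hp n) (pow_le_one' hx n)

theorem Valuation.eval_le_one {p : F[X]} (hp : ∀ k, w (p.coeff k) ≤ 1) {x : F} (hx : w x ≤ 1) :
    w (p.eval x) ≤ 1 :=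
  Valuation.eval₂_le_one (i := RingHom.id F) hp hx

theorem Valuation.coeff_divByMonic_le_one {p : F[X]} (hp : ∀ k, w (p.coeff k) ≤ 1) {a : F}
    (ha : w a ≤ 1) (k : ℕ) : w ((p /ₘ (X - C a)).coeff k) ≤ 1 := by
  rw [coeff_divByMonic_X_sub_C]
  refine w.map_sum_le fun n _ => ?_
  rw [map_mul, map_pow]
  exact mul_le_one' (pow_le_one' ha _) (hp _)

theorem Valuation.eval_sub_eval_le {p : F[X]} (hp : ∀ k, w (p.coeff k) ≤ 1) {x y : F}
    (hx : w x ≤ 1) (hy : w y ≤ 1) : w (p.eval x - p.eval y) ≤ w (x - y) := by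
  have h := congrArg (eval x) (modByMonic_add_div p (X - C y))
  rw [modByMonic_X_sub_C_eq_C_eval] at h
  simp only [eval_add, eval_C, eval_mul, eval_sub, eval_X] at h
  rw [← h, add_sub_cancel_left, map_mul]
  exact mul_le_of_le_one_right' (Valuation.eval_le_one (Valuation.coeff_divByMonic_le_one hp hy) hx)

variable {E : Type*} [Field E] {ΓE : Type*} [LinearOrderedCommGroupWithZero ΓE]
  {vE : Valuation E ΓE} {i : E →+* F}

/-- Monic integral polynomials of positive degree less than `d` have approximate roots. -/
def HasApproxRoots (vE : Valuation E ΓE) (d : ℕ) : Prop :=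
  ∀ g : E[X], g.Monic → g.natDegree ≠ 0 → g.natDegree < d → (∀ k, vE (g.coeff k) ≤ 1) →
    ∃ a, vE a ≤ 1 ∧ vE (g.eval a) < 1

theorem HasApproxRoots.eval₂_eq_one (hE : vE.IsEquiv (w.comap i)) {d : ℕ}
    (hd : HasApproxRoots vE d) {u : F} (hu : w u ≤ 1)
    (hu' : ∀ e, vE e ≤ 1 → w (u - i e) = 1) (n : ℕ) :
    ∀ h : E[X], h.natDegree ≤ n → n < d → (∀ k, vE (h.coeff k) ≤ 1) →
      (∃ k, vE (h.coeff k) = 1) → w (h.eval₂ i u) = 1 := by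
  have hle : ∀ a, vE a ≤ 1 ↔ w (i a) ≤ 1 := fun a => hE.le_one_iff_le_one
  have hlt : ∀ a, vE a < 1 ↔ w (i a) < 1 := fun a => hE.lt_one_iff_lt_one
  have heq : ∀ a, vE a = 1 ↔ w (i a) = 1 := fun a => hE.eq_one_iff_eq_one
  induction n with
  | zero =>
    rintro h hn - - ⟨k, hk⟩
    rw [eq_C_of_natDegree_le_zero hn, eval₂_C]
    rw [← heq]
    rcases eq_or_ne k 0 with rfl | hk0
    · exact hk
    · rw [coeff_eq_zero_of_natDegree_lt (by omega)] at hk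
      simp at hk
  | succ n ih =>
    rintro h hn hnd h_int ⟨k, hk⟩
    rcases (h_int (n + 1)).lt_or_eq with hc | hc
    · have hkn : k ≠ n + 1 := by rintro rfl; exact hc.ne hk
      have h1 : w ((h.erase (n + 1)).eval₂ i u) = 1 := by
        refine ih _ ?_ (by omega) (fun l => ?_) ⟨k, ?_⟩
        · rw [natDegree_le_iff_coeff_eq_zero]
          intro N hN
          rw [coeff_erase]
          split_ifs with hN1
          · rfl
          · exact coeff_eq_zero_of_natDegree_lt (by omega)
        · rw [coeff_erase]
          split_ifs
          · simp
          · exact h_int l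
        · rw [coeff_erase, if_neg hkn, hk]
      rw [← monomial_add_erase h (n + 1), eval₂_add, eval₂_monomial]
      have h2 : w (i (h.coeff (n + 1)) * u ^ (n + 1)) < 1 := by
        rw [map_mul, map_pow]
        exact mul_lt_one_of_lt_of_le ((hlt _).1 hc) (pow_le_one' hu _)
      rw [Valuation.map_add_eq_of_lt_right _ (by rw [h1]; exact h2)]
      exact h1
    · have hc0 : h.coeff (n + 1) ≠ 0 := by
        intro h0
        rw [h0] at hc
        simp at hc
      have hdeg : h.natDegree = n + 1 := le_antisymm hn (le_natDegree_of_ne_zero hc0)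
      have hlead : h.leadingCoeff = h.coeff (n + 1) := by rw [leadingCoeff, hdeg]
      obtain ⟨a, ha, hga⟩ := hd (C (h.coeff (n + 1))⁻¹ * h)
        (by rw [← hlead, mul_comm]
            exact monic_mul_leadingCoeff_inv (by
              rintro rfl
              simp at hc0))
        (by rw [natDegree_C_mul (inv_ne_zero hc0)]; omega)
        (by rw [natDegree_C_mul (inv_ne_zero hc0)]; omega)
        (fun l => by simpa [hc] using h_int l)
      have hha : vE (h.eval a) < 1 := by simpa [hc] using hga
      have hq := ih (h /ₘ (X - C a)) (by rw [natDegree_divByMonic _ (monic_X_sub_C a)]; simp; omega)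
        (by omega) (Valuation.coeff_divByMonic_le_one h_int ha) ⟨n, by
          rw [coeff_divByMonic_X_sub_C, hdeg]
          simp [hc]⟩
      have hdiv := congrArg (eval₂ i u) (modByMonic_add_div h (X - C a))
      rw [modByMonic_X_sub_C_eq_C_eval] at hdiv
      simp only [eval₂_add, eval₂_C, eval₂_mul, eval₂_sub, eval₂_X] at hdiv
      have h1 : w ((u - i a) * eval₂ i u (h /ₘ (X - C a))) = 1 := by
        rw [map_mul, hq, hu' a ha, one_mul]
      rw [← hdiv, Valuation.map_add_eq_of_lt_right _ (by rw [h1]; exact (hlt _).1 hha)]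
      exact h1

theorem HasApproxRoots.eval₂_eq (hE : vE.IsEquiv (w.comap i)) {d : ℕ}
    (hd : HasApproxRoots vE d) {u : F} (hu : w u ≤ 1)
    (hu' : ∀ e, vE e ≤ 1 → w (u - i e) = 1) {h : E[X]} (hdeg : h.natDegree < d) {k : ℕ}
    (hk : ∀ l, vE (h.coeff l) ≤ vE (h.coeff k)) : w (h.eval₂ i u) = w (i (h.coeff k)) := by
  rcases eq_or_ne (h.coeff k) 0 with h0 | h0
  · have : h = 0 := by
      ext l
      simpa [h0] using hk l
    simp [this]
  · have h0' : vE (h.coeff k) ≠ 0 := (Valuation.ne_zero_iff _).2 h0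
    have := hd.eval₂_eq_one hE hu hu' h.natDegree (C (h.coeff k)⁻¹ * h)
      (natDegree_C_mul_le _ _) hdeg (fun l => by
        simp only [coeff_C_mul, map_mul, map_inv₀]
        exact inv_mul_le_one_of_le₀ (hk l) zero_le) ⟨k, by simp [h0']⟩
    rw [eval₂_mul, eval₂_C, map_mul, map_inv₀, map_inv₀] at this
    have h1 : w (i (h.coeff k)) ≠ 0 := (Valuation.ne_zero_iff _).2 (by simpa using h0)
    field_simp at this
    exact this

theorem Polynomial.exists_coeff_max (vE : Valuation E ΓE) (h : E[X]) :
    ∃ k, ∀ l, vE (h.coeff l) ≤ vE (h.coeff k) := by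
  obtain ⟨k, -, hk⟩ := Finset.exists_max_image (Finset.range (h.natDegree + 1))
    (fun l => vE (h.coeff l)) ⟨0, by simp⟩
  refine ⟨k, fun l => ?_⟩
  by_cases hl : l ∈ Finset.range (h.natDegree + 1)
  · exact hk l hl
  · rw [coeff_eq_zero_of_natDegree_lt (by simpa using hl)]
    simp

end

section

variable {F : Type*} [Field F] {Γ : Type*} [LinearOrderedCommGroupWithZero Γ]
variable {w : Valuation F Γ} {γ : Γ}

theorem LaurentLike.exists_pow_eq (hA : LaurentLike w γ) {u : F} (hu : w u = 1) {n : ℕ}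
    (hn : 0 < n) : ∃ z, z ^ n = u := by
  have hcoeff : ∀ k, w ((X ^ n - C u : F[X]).coeff k) ≤ 1 := by
    intro k
    rw [coeff_sub, coeff_X_pow, coeff_C]
    refine w.map_sub_le ?_ ?_
    · split_ifs <;> simp
    · split_ifs <;> simp [hu]
  obtain ⟨x, hx, hx'⟩ := hA.resAlg (X ^ n - C u) (monic_X_pow_sub_C u hn.ne')
    (by rw [natDegree_X_pow_sub_C]; exact hn.ne') hcoeff
  have hx1 : w x = 1 := by
    have h : w (x ^ n - u) < 1 := by simpa using hx'
    have h2 : w (x ^ n) = w u := w.map_eq_of_sub_lt (by rwa [hu])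
    rw [map_pow, hu] at h2
    exact (pow_left_inj₀ zero_le zero_le hn.ne').1 (h2.trans (one_pow n).symm)
  obtain ⟨r, hr, -⟩ := hA.hensel _ hcoeff x hx hx' (by
    simp [derivative_X_pow, hx1, hA.nat n hn.ne'])
  exact ⟨r, by simpa [sub_eq_zero] using hr⟩

theorem LaurentLike.isPowVal_iff (hA : LaurentLike w γ) {x : F} {n : ℕ} (hn : 0 < n) :
    IsPowVal w n x ↔ ∃ y, x = y ^ n := by
  constructor
  · rintro ⟨z, hz⟩
    rcases eq_or_ne x 0 with rfl | hx
    · exact ⟨0, by simp [hn.ne']⟩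
    have hwx : w x ≠ 0 := (Valuation.ne_zero_iff _).2 hx
    have hz0 : z ≠ 0 := by
      rintro rfl
      rw [map_zero, zero_pow hn.ne'] at hz
      exact hwx hz
    obtain ⟨y, hy⟩ := hA.exists_pow_eq (u := x / z ^ n) (by
      rw [map_div₀, map_pow, ← hz, div_self hwx]) hn
    exact ⟨y * z, by rw [mul_pow, hy, div_mul_cancel₀ _ (pow_ne_zero _ hz0)]⟩
  · rintro ⟨y, rfl⟩
    exact ⟨y, map_pow _ _ _⟩

variable {E : Type*} [Field E] {i j : E →+* F}

theorem SameVal.swap (h : SameVal w γ i j) : SameVal w γ j i :=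
  ⟨fun a b => (h.le_iff a b).symm, fun a n hn => (h.pow_iff a n hn).symm,
    h.unif.imp fun _ => And.symm⟩

theorem HasApproxRoots.exists_root (hA : LaurentLike w γ) {ΓE : Type*}
    [LinearOrderedCommGroupWithZero ΓE] {vE : Valuation E ΓE} (hE : vE.IsEquiv (w.comap i))
    {g : E[X]} (hg : g.Monic) (hdeg : g.natDegree ≠ 0) (hd : HasApproxRoots vE g.natDegree)
    (h_int : ∀ k, vE (g.coeff k) ≤ 1) (hnr : ∀ a, vE a ≤ 1 → vE (g.eval a) = 1) :
    ∃ r, g.eval₂ i r = 0 ∧ w r ≤ 1 ∧ ∀ e, vE e ≤ 1 → w (r - i e) = 1 := by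
  have hle : ∀ a, vE a ≤ 1 ↔ w (i a) ≤ 1 := fun a => hE.le_one_iff_le_one
  have heq : ∀ a, vE a = 1 ↔ w (i a) = 1 := fun a => hE.eq_one_iff_eq_one
  have hcoeff : ∀ k, w ((g.map i).coeff k) ≤ 1 := fun k => by
    rw [coeff_map]
    exact (hle _).1 (h_int k)
  obtain ⟨x, hx, hx'⟩ := hA.resAlg (g.map i) (hg.map i) (by rwa [natDegree_map]) hcoeff
  have hgen : ∀ y, w y ≤ 1 → w ((g.map i).eval y) < 1 → ∀ e, vE e ≤ 1 → w (y - i e) = 1 := by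
    intro y hy hy' e he
    have he' := (hle e).1 he
    refine le_antisymm (w.map_sub_le hy he') (le_of_not_gt fun hlt => ?_)
    have h1 := (Valuation.eval_sub_eval_le hcoeff hy he').trans_lt hlt
    have h2 : w ((g.map i).eval (i e)) < 1 := by
      rw [← sub_sub_cancel ((g.map i).eval y) ((g.map i).eval (i e))]
      exact w.map_sub_lt hy' h1
    rw [eval_map, eval₂_at_apply] at h2
    exact h2.ne ((heq _).1 (hnr e he))
  have hnat : ∀ n : ℕ, n ≠ 0 → vE (n : E) = 1 := fun n hn => by
    rw [heq, map_natCast]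
    exact hA.nat n hn
  have hnat' : ∀ n : ℕ, vE (n : E) ≤ 1 := fun n => by
    rcases eq_or_ne n 0 with rfl | hn
    · simp
    · exact (hnat n hn).le
  have hder : w ((g.map i).derivative.eval x) = 1 := by
    rw [derivative_map, eval_map]
    refine hd.eval₂_eq_one hE hx (hgen x hx hx') _ _ le_rfl (natDegree_derivative_lt hdeg)
      (fun k => ?_) ⟨g.natDegree - 1, ?_⟩
    · rw [coeff_derivative, map_mul]
      have := hnat' (k + 1)
      push_cast at this
      exact mul_le_one' (h_int _) this
    · rw [coeff_derivative]
      have h1 : g.natDegree - 1 + 1 = g.natDegree := by omega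
      have h2 : ((g.natDegree - 1 : ℕ) : E) + 1 = (g.natDegree : ℕ) := by
        exact_mod_cast congrArg (Nat.cast : ℕ → E) h1
      rw [h1, h2, hg.coeff_natDegree, one_mul]
      exact hnat _ hdeg
  obtain ⟨r, hr, hrx⟩ := hA.hensel _ hcoeff x hx hx' hder
  have hr1 : w r ≤ 1 := by
    rw [← sub_add_cancel r x]
    exact w.map_add_le hrx.le hx
  refine ⟨r, by rwa [eval_map] at hr, hr1, hgen r hr1 ?_⟩
  rw [hr, map_zero]
  exact zero_lt_one

theorem AlgMaximal.hasApproxRoots (hA : LaurentLike w γ) (hS : SameVal w γ i j)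
    (hM : AlgMaximal w i j) (d : ℕ) : HasApproxRoots (w.comap i) d := by
  have hEi : (w.comap i).IsEquiv (w.comap i) := Valuation.IsEquiv.refl
  induction d with
  | zero => intro g _ _ h; omega
  | succ d ih =>
    intro g hg h0 hd h_int
    rcases Nat.lt_succ_iff_lt_or_eq.1 hd with hlt | rfl
    · exact ih g hg h0 hlt h_int
    by_contra! hcon
    have hnr : ∀ a, (w.comap i) a ≤ 1 → (w.comap i) (g.eval a) = 1 := fun a ha =>
      le_antisymm (Valuation.eval_le_one h_int ha) (hcon a ha)
    obtain ⟨r, hr, hr1, hru⟩ := ih.exists_root hA hEi hg h0 h_int hnr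
    obtain ⟨r', hr', hr1', hru'⟩ := ih.exists_root hA hS.isEquiv hg h0 h_int hnr
    have hcompat : Compat w i j r r' := by
      refine Compat.of_eq hS fun h => ?_
      obtain ⟨k, hk⟩ := Polynomial.exists_coeff_max (w.comap i) (h %ₘ g)
      have hlt : (h %ₘ g).natDegree < g.natDegree :=
        natDegree_modByMonic_lt _ hg (by rintro rfl; simp at h0)
      refine ⟨(h %ₘ g).coeff k, ?_, ?_⟩
      · rw [← eval₂_modByMonic_eq_self_of_root hr]
        exact ih.eval₂_eq hEi hr1 hru hlt hk
      · rw [← eval₂_modByMonic_eq_self_of_root hr']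
        exact ih.eval₂_eq hS.isEquiv hr1' hru' hlt hk
    obtain ⟨e, rfl⟩ := hM r r' ⟨g, hg.ne_zero, hr⟩ hcompat
    have := hru e hr1
    simp at this

theorem exists_monomial_eq {x x' : F} (hle : ∀ (a b : E) (m n : ℕ),
      w (i a * x ^ m) ≤ w (i b * x ^ n) ↔ w (j a * x' ^ m) ≤ w (j b * x' ^ n)) (g : E[X])
    (hne : ∀ a b : E, a ≠ 0 → b ≠ 0 → ∀ k l, k < l → l ≤ g.natDegree →
      w (i a * x ^ k) ≠ w (i b * x ^ l)) :
    ∃ k, w (g.eval₂ i x) = w (i (g.coeff k) * x ^ k) ∧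
      w (g.eval₂ j x') = w (j (g.coeff k) * x' ^ k) := by
  classical
  rcases eq_or_ne g 0 with rfl | hg
  · exact ⟨0, by simp⟩
  obtain ⟨k, hk, hmax⟩ := Finset.exists_max_image g.support
    (fun l => w (i (g.coeff l) * x ^ l)) (nonempty_support_iff.2 hg)
  have hlt : ∀ l ∈ g.support \ {k}, w (i (g.coeff l) * x ^ l) < w (i (g.coeff k) * x ^ k) := by
    intro l hl
    rw [Finset.mem_sdiff, Finset.mem_singleton] at hl
    refine lt_of_le_of_ne (hmax l hl.1) ?_
    have hl0 := mem_support_iff.1 hl.1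
    have hk0 := mem_support_iff.1 hk
    rcases lt_or_gt_of_ne hl.2 with h | h
    · exact hne _ _ hl0 hk0 l k h (le_natDegree_of_ne_zero hk0)
    · exact (hne _ _ hk0 hl0 k l h (le_natDegree_of_ne_zero hl0)).symm
  refine ⟨k, ?_, ?_⟩
  · rw [eval₂_eq_sum, Polynomial.sum_def]
    exact w.map_sum_eq_of_lt hk hlt
  · rw [eval₂_eq_sum, Polynomial.sum_def]
    refine w.map_sum_eq_of_lt (f := fun l => j (g.coeff l) * x' ^ l) hk fun l hl => ?_
    have := hlt l hl
    rw [← not_le] at this ⊢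
    rwa [hle] at this

theorem Compat.of_pow_eq (hS : SameVal w γ i j) {x x' : F} {d : ℕ} (hd : 0 < d) {c : E}
    (hc : c ≠ 0) (hx : x ^ d = i c) (hx' : x' ^ d = j c)
    (hmin : ∀ k, 0 < k → k < d → ∀ a : E, w (x ^ k) ≠ w (i a)) : Compat w i j x x' := by
  have hx0 : x ≠ 0 := by
    rintro rfl
    rw [zero_pow hd.ne'] at hx
    exact hc (by simpa using hx.symm)
  have hpw : ∀ (a : E) m, w (i a * x ^ m) ^ d = w (i (a ^ d * c ^ m)) := by
    intro a m
    rw [← map_pow, mul_pow, ← pow_mul, mul_comm m, pow_mul, hx]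
    simp
  have hpw' : ∀ (a : E) m, w (j a * x' ^ m) ^ d = w (j (a ^ d * c ^ m)) := by
    intro a m
    rw [← map_pow, mul_pow, ← pow_mul, mul_comm m, pow_mul, hx']
    simp
  have hple : ∀ a b : Γ, a ≤ b ↔ a ^ d ≤ b ^ d := fun a b =>
    (pow_le_pow_iff_left₀ zero_le zero_le hd.ne').symm
  have hle : ∀ (a b : E) (m n : ℕ),
      w (i a * x ^ m) ≤ w (i b * x ^ n) ↔ w (j a * x' ^ m) ≤ w (j b * x' ^ n) := by
    intro a b m n
    rw [hple, hpw, hpw, hS.le_iff, ← hpw', ← hpw', ← hple]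
  have hpiff : ∀ (n : ℕ) (y z : F), y ^ d = z → (IsPowVal w n y ↔ IsPowVal w (n * d) z) := by
    rintro n y z rfl
    refine exists_congr fun z => ?_
    rw [map_pow, pow_mul]
    constructor
    · intro h
      rw [h]
    · intro h
      exact (pow_left_inj₀ zero_le zero_le hd.ne').1 h
  refine Compat.of_monomial hle (fun a m n hn => ?_) fun g => ?_
  · rw [hpiff n _ (i (a ^ d * c ^ m)), hpiff n _ (j (a ^ d * c ^ m))]
    · exact hS.pow_iff _ _ (Nat.mul_pos hn hd)
    · rw [mul_pow, ← pow_mul, mul_comm m, pow_mul, hx']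
      simp
    · rw [mul_pow, ← pow_mul, mul_comm m, pow_mul, hx]
      simp
  · have hmonic : (X ^ d - C c : E[X]).Monic := monic_X_pow_sub_C c hd.ne'
    have hndeg : (X ^ d - C c : E[X]).natDegree = d := natDegree_X_pow_sub_C
    have hlt : (g %ₘ (X ^ d - C c)).natDegree < d := by
      have := natDegree_modByMonic_lt g hmonic (by
        intro h
        rw [h, natDegree_one] at hndeg
        omega)
      rwa [hndeg] at this
    obtain ⟨k, h1, h2⟩ := exists_monomial_eq hle (g %ₘ (X ^ d - C c)) (by
      intro a b ha hb k l hkl hl heq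
      refine hmin (l - k) (by omega) (by omega) (a / b) ?_
      rw [show x ^ l = x ^ (l - k) * x ^ k by rw [← pow_add]; congr; omega, ← mul_assoc, map_mul,
        map_mul] at heq
      have h1 := mul_right_cancel₀ ((Valuation.ne_zero_iff _).2 (pow_ne_zero k hx0)) heq
      have hb' : w (i b) ≠ 0 := (Valuation.ne_zero_iff _).2 (by simpa using hb)
      rw [map_div₀, map_div₀, h1, map_mul, mul_div_cancel_left₀ _ hb'])
    refine ⟨(g %ₘ (X ^ d - C c)).coeff k, k, ?_, ?_⟩
    · exact (congrArg w (eval₂_modByMonic_eq_self_of_root (by simp [hx])).symm).trans h1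
    · exact (congrArg w (eval₂_modByMonic_eq_self_of_root (by simp [hx'])).symm).trans h2

theorem AlgMaximal.exists_pow_eq (hA : LaurentLike w γ) (hS : SameVal w γ i j)
    (hM : AlgMaximal w i j) {n : ℕ} (hn : 0 < n) {a : E} {z : F} (hz : w (i a) = w z ^ n) :
    ∃ c : E, w (i c) = w z := by
  classical
  rcases eq_or_ne z 0 with rfl | hz0
  · exact ⟨0, by simp⟩
  have hex : ∃ d, 0 < d ∧ ∃ c : E, w z ^ d = w (i c) := ⟨n, hn, a, hz.symm⟩
  obtain ⟨hd, c, hc⟩ := Nat.find_spec hex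
  set d := Nat.find hex
  have hc0 : c ≠ 0 := by
    rintro rfl
    rw [map_zero, map_zero] at hc
    exact pow_ne_zero d ((Valuation.ne_zero_iff _).2 hz0) hc
  obtain ⟨x, hx⟩ := (hA.isPowVal_iff hd).1 ⟨z, hc.symm⟩
  obtain ⟨x', hx'⟩ := (hA.isPowVal_iff hd).1 ((hS.pow_iff c d hd).1 ⟨z, hc.symm⟩)
  have hxz : w x = w z := by
    refine (pow_left_inj₀ zero_le zero_le hd.ne').1 ?_
    rw [hc, hx, map_pow]
  have hcompat : Compat w i j x x' := by
    refine Compat.of_pow_eq hS hd hc0 hx.symm hx'.symm fun k hk hkd b hb => ?_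
    refine Nat.find_min hex hkd ⟨hk, b, ?_⟩
    rw [← hb, map_pow, hxz]
  obtain ⟨e, he⟩ := hM x x' ⟨X ^ d - C c, (monic_X_pow_sub_C c hd.ne').ne_zero, by
    simp [← hx]⟩ hcompat
  exact ⟨e, by rw [he, hxz]⟩

end

section

variable {F : Type*} [Field F] {Γ : Type*} [LinearOrderedCommGroupWithZero Γ]
variable {w : Valuation F Γ} {γ : Γ}
variable {E : Type*} [Field E] {ΓE : Type*} [LinearOrderedCommGroupWithZero ΓE]
variable {v : Valuation E ΓE} {i : E →+* F} {a : ℕ → E}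

/-- Pseudo-Cauchy sequences, normalised so that all differences are controlled from the start. -/
structure IsPseudoCauchy (v : Valuation E ΓE) (a : ℕ → E) : Prop where
  eq : ∀ n m, n < m → v (a m - a n) = v (a (n + 1) - a n)
  anti : StrictAnti fun n => v (a (n + 1) - a n)

/-- The value of `h` is eventually constant along `a`. -/
def StabilizesAlong (v : Valuation E ΓE) (a : ℕ → E) (h : E[X]) : Prop :=
  ∃ β, ∀ᶠ n in atTop, v (h.eval (a n)) = β

/-- `r` is a pseudo-limit of the sequence `a`. -/
def IsPseudoLimit (w : Valuation F Γ) (i : E →+* F) (a : ℕ → E) (r : F) : Prop :=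
  ∀ n, w (r - i (a n)) = w (i (a (n + 1) - a n))

/-- The `k`-th Taylor term of `h` at `a n` strictly dominates all the other nonconstant ones. -/
def TaylorDominates (v : Valuation E ΓE) (a : ℕ → E) (h : E[X]) (k n : ℕ) : Prop :=
  ∀ l, 1 ≤ l → l ≠ k →
    v ((hasseDeriv l h).eval (a n)) * v (a (n + 1) - a n) ^ l <
      v ((hasseDeriv k h).eval (a n)) * v (a (n + 1) - a n) ^ k

theorem IsPseudoCauchy.pos (ha : IsPseudoCauchy v a) (n : ℕ) : 0 < v (a (n + 1) - a n) :=
  zero_le.trans_lt (ha.anti n.lt_succ_self)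

theorem eventually_lt_or_lt {c : ℕ → ΓE} (hc : StrictAnti c) {β₁ β₂ : ΓE} (h₁ : β₁ ≠ 0)
    {k l : ℕ} (hkl : k < l) :
    (∀ᶠ n in atTop, β₁ * c n ^ l < β₂ * c n ^ k) ∨ (∀ᶠ n in atTop, β₂ * c n ^ k < β₁ * c n ^ l) := by
  have hpos : ∀ n, 0 < c n := fun n => zero_le.trans_lt (hc n.lt_succ_self)
  have hsplit : ∀ n, c n ^ l = c n ^ (l - k) * c n ^ k := fun n => by
    rw [← pow_add]; congr; omega
  have key : ∀ n, c (n + 1) ^ (l - k) < c n ^ (l - k) := fun n =>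
    pow_lt_pow_left₀ (hc n.lt_succ_self) zero_le (by omega)
  have hanti : StrictAnti fun n => β₁ * c n ^ (l - k) := strictAnti_nat_of_succ_lt fun n =>
    (mul_lt_mul_iff_right₀ (zero_lt_iff.2 h₁)).2 (key n)
  by_cases hex : ∃ n, β₁ * c n ^ (l - k) < β₂
  · obtain ⟨N, hN⟩ := hex
    refine Or.inl (eventually_atTop.2 ⟨N, fun n hn => ?_⟩)
    rw [hsplit, ← mul_assoc]
    exact (mul_lt_mul_iff_left₀ (pow_pos (hpos n) k)).2 ((hanti.antitone hn).trans_lt hN)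
  · push Not at hex
    refine Or.inr (Eventually.of_forall fun n => ?_)
    rw [hsplit, ← mul_assoc]
    exact (mul_lt_mul_iff_left₀ (pow_pos (hpos n) k)).2 ((hex (n + 1)).trans_lt
      (hanti n.lt_succ_self))

theorem exists_eventually_dominates {c : ℕ → ΓE} (hc : StrictAnti c) {β : ℕ → ΓE}
    {I : Finset ℕ} (hI : I.Nonempty) (hβ : ∀ k ∈ I, β k ≠ 0) :
    ∃ k ∈ I, ∀ᶠ n in atTop, ∀ l ∈ I, l ≠ k → β l * c n ^ l < β k * c n ^ k := by
  induction hI using Finset.Nonempty.cons_induction with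
  | singleton k => exact ⟨k, by simp, Eventually.of_forall fun n l hl hlk => by simp_all⟩
  | cons m s hm hs ih =>
    obtain ⟨k, hk, hev⟩ := ih fun k hk => hβ k (Finset.mem_cons_of_mem hk)
    have hmk : m ≠ k := by rintro rfl; exact hm hk
    have hm0 := hβ m (Finset.mem_cons_self _ _)
    have hk0 := hβ k (Finset.mem_cons_of_mem hk)
    have hcmp : (∀ᶠ n in atTop, β m * c n ^ m < β k * c n ^ k) ∨
        (∀ᶠ n in atTop, β k * c n ^ k < β m * c n ^ m) := by
      rcases lt_or_gt_of_ne hmk with h | h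
      · exact (eventually_lt_or_lt hc hk0 h).symm
      · exact eventually_lt_or_lt hc hm0 h
    rcases hcmp with h | h
    · refine ⟨k, Finset.mem_cons_of_mem hk, ?_⟩
      filter_upwards [hev, h] with n h1 h2 l hl hlk
      rcases Finset.mem_cons.1 hl with rfl | hl
      · exact h2
      · exact h1 l hl hlk
    · refine ⟨m, Finset.mem_cons_self _ _, ?_⟩
      filter_upwards [hev, h] with n h1 h2 l hl hlm
      rcases Finset.mem_cons.1 hl with rfl | hl
      · exact absurd rfl hlm
      · rcases eq_or_ne l k with rfl | hlk
        · exact h2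
        · exact (h1 l hl hlk).trans h2

theorem IsPseudoCauchy.exists_taylorDominates (ha : IsPseudoCauchy v a) {h : E[X]}
    (hdeg : h.natDegree ≠ 0) (hst : ∀ l, 1 ≤ l → StabilizesAlong v a (hasseDeriv l h)) :
    ∃ k, 1 ≤ k ∧ ∃ β, β ≠ 0 ∧ ∀ᶠ n in atTop,
      v ((hasseDeriv k h).eval (a n)) = β ∧ TaylorDominates v a h k n := by
  classical
  choose! β hβ using hst
  have hlead : β h.natDegree ≠ 0 := by
    obtain ⟨n, hn⟩ := (hβ h.natDegree (by omega)).exists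
    rw [← hn, hasseDeriv_natDegree_eq_C, eval_C, Valuation.ne_zero_iff, leadingCoeff_ne_zero]
    rintro rfl
    simp at hdeg
  obtain ⟨k, hk, hev⟩ := exists_eventually_dominates ha.anti (β := β)
    (I := {l ∈ Finset.Icc 1 h.natDegree | β l ≠ 0})
    ⟨h.natDegree, by simp [hlead]; omega⟩ (fun k hk => (Finset.mem_filter.1 hk).2)
  rw [Finset.mem_filter, Finset.mem_Icc] at hk
  have hall : ∀ᶠ n in atTop, ∀ l ∈ Finset.Icc 1 h.natDegree,
      v ((hasseDeriv l h).eval (a n)) = β l :=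
    (Finset.eventually_all _).2 fun l hl => hβ l (Finset.mem_Icc.1 hl).1
  refine ⟨k, hk.1.1, β k, hk.2, ?_⟩
  filter_upwards [hev, hall] with n h1 h2
  have hkn := h2 k (Finset.mem_Icc.2 hk.1)
  refine ⟨hkn, fun l hl hlk => ?_⟩
  rw [hkn]
  have hpos : 0 < β k * v (a (n + 1) - a n) ^ k :=
    mul_pos (zero_lt_iff.2 hk.2) (pow_pos (ha.pos n) k)
  by_cases hld : l ≤ h.natDegree
  · rw [h2 l (Finset.mem_Icc.2 ⟨hl, hld⟩)]
    by_cases hl0 : β l = 0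
    · rw [hl0, zero_mul]
      exact hpos
    · exact h1 l (by simp [hl, hld, hl0]) hlk
  · rw [hasseDeriv_eq_zero_of_lt_natDegree _ _ (not_le.1 hld)]
    simpa using hpos

theorem TaylorDominates.eval₂_sub (hE : v.IsEquiv (w.comap i)) {h : E[X]} {k n : ℕ} (hk : 1 ≤ k)
    (hdom : TaylorDominates v a h k n) (hk0 : (hasseDeriv k h).eval (a n) ≠ 0) {y : F}
    (hy : w (y - i (a n)) = w (i (a (n + 1) - a n))) :
    w (h.eval₂ i y - i (h.eval (a n))) =
      w (i ((hasseDeriv k h).eval (a n) * (a (n + 1) - a n) ^ k)) := by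
  classical
  have hkd : k ≤ h.natDegree := by
    by_contra hlt
    rw [hasseDeriv_eq_zero_of_lt_natDegree _ _ (not_le.1 hlt)] at hk0
    simp at hk0
  have hsum : h.eval₂ i y - i (h.eval (a n)) = ∑ l ∈ Finset.range h.natDegree,
      i ((hasseDeriv (l + 1) h).eval (a n)) * (y - i (a n)) ^ (l + 1) := by
    have h1 : h.eval₂ i y = (taylor (a n) h).eval₂ i (y - i (a n)) := by
      rw [← eval_map, ← eval_map, map_taylor, taylor_eval, sub_add_cancel]
    rw [h1, eval₂_eq_sum_range, natDegree_taylor, Finset.sum_range_succ']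
    simp [taylor_coeff]
  have hterm : ∀ l, w (i ((hasseDeriv l h).eval (a n)) * (y - i (a n)) ^ l) =
      w (i ((hasseDeriv l h).eval (a n) * (a (n + 1) - a n) ^ l)) := by
    intro l
    rw [map_mul, map_pow, hy, map_mul, map_mul, map_pow, map_pow]
  obtain ⟨k, rfl⟩ := Nat.exists_eq_add_of_le' hk
  rw [hsum, w.map_sum_eq_of_lt (j := k) (f := fun l =>
    i ((hasseDeriv (l + 1) h).eval (a n)) * (y - i (a n)) ^ (l + 1)) (by simpa using hkd), hterm]
  intro l hl
  rw [Finset.mem_sdiff, Finset.mem_singleton] at hl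
  rw [hterm, hterm]
  refine hE.lt_iff_lt.1 ?_
  simpa using hdom (l + 1) (by omega) (by omega)

theorem TaylorDominates.eval_sub (ha : IsPseudoCauchy v a) {h : E[X]} {k n m : ℕ} (hk : 1 ≤ k)
    (hdom : TaylorDominates v a h k n) (hk0 : (hasseDeriv k h).eval (a n) ≠ 0) (hnm : n < m) :
    v (h.eval (a m) - h.eval (a n)) =
      v ((hasseDeriv k h).eval (a n)) * v (a (n + 1) - a n) ^ k := by
  have := hdom.eval₂_sub (i := RingHom.id E) (w := v) (y := a m)
    (Valuation.IsEquiv.refl (v := v)) hk hk0 (ha.eq n m hnm)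
  simpa using this

theorem IsPseudoCauchy.eval₂_eq (ha : IsPseudoCauchy v a) (hE : v.IsEquiv (w.comap i)) {h : E[X]}
    (hst : ∀ l, StabilizesAlong v a (hasseDeriv l h)) {r : F} (hr : IsPseudoLimit w i a r) :
    ∀ᶠ n in atTop, w (h.eval₂ i r) = w (i (h.eval (a n))) := by
  rcases eq_or_ne h.natDegree 0 with hdeg | hdeg
  · rw [natDegree_eq_zero] at hdeg
    obtain ⟨c, rfl⟩ := hdeg
    simp
  obtain ⟨k, hk, β, hβ, hev⟩ := ha.exists_taylorDominates hdeg fun l _ => hst l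
  obtain ⟨β₀, hβ₀⟩ := hst 0
  rw [hasseDeriv_zero'] at hβ₀
  obtain ⟨N, hN⟩ := eventually_atTop.1 (hev.and hβ₀)
  have hk0 : ∀ n ≥ N, (hasseDeriv k h).eval (a n) ≠ 0 := fun n hn h0 => by
    have := (hN n hn).1.1
    rw [h0, map_zero] at this
    exact hβ this.symm
  refine eventually_atTop.2 ⟨N + 1, fun n hn => ?_⟩
  have h1 : v ((hasseDeriv k h).eval (a n) * (a (n + 1) - a n) ^ k) < v (h.eval (a n)) := by
    obtain ⟨m, rfl⟩ := Nat.exists_eq_add_of_le' hn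
    have h2 := (hN (m + N) (by omega)).1.2.eval_sub ha hk (hk0 (m + N) (by omega))
      (Nat.lt_succ_self _)
    have h3 : v (h.eval (a (m + N + 1)) - h.eval (a (m + N))) ≤ β₀ :=
      v.map_sub_le (hN (m + N + 1) (by omega)).2.le (hN (m + N) (by omega)).2.le
    rw [h2, (hN (m + N) (by omega)).1.1] at h3
    rw [map_mul, map_pow, ← add_assoc, (hN (m + N + 1) (by omega)).1.1,
      (hN (m + N + 1) (by omega)).2]
    refine lt_of_lt_of_le ((mul_lt_mul_iff_right₀ (zero_lt_iff.2 hβ)).2 ?_) h3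
    exact pow_lt_pow_left₀ (ha.anti (Nat.lt_succ_self _)) zero_le (by omega)
  have h2 := (hN n (by omega)).1.2.eval₂_sub hE hk (hk0 n (by omega)) (hr n)
  refine w.map_eq_of_sub_lt ?_
  rw [h2]
  exact hE.lt_iff_lt.1 h1

theorem LaurentLike.exists_eval_eq_zero (hA : LaurentLike w γ) (p : F[X])
    (h0 : w (p.coeff 0) ≤ 1) (h1 : p.coeff 1 = 1) (h2 : ∀ l, 2 ≤ l → w (p.coeff l) < 1) :
    ∃ y, w y ≤ 1 ∧ p.eval y = 0 := by
  have hcoeff : ∀ k, w (p.coeff k) ≤ 1 := by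
    rintro (_ | _ | k)
    · exact h0
    · simp [h1]
    · exact (h2 _ (by omega)).le
  set R := p - C (p.coeff 0) - X with hR
  have hRc : ∀ k, w (R.coeff k) < 1 := by
    rintro (_ | _ | k)
    · simp [hR]
    · simp [hR, h1]
    · simpa [hR, coeff_C, coeff_X] using h2 (k + 2) (by omega)
  have hnat : ∀ n : ℕ, w (n : F) ≤ 1 := fun n => by
    rcases eq_or_ne n 0 with rfl | hn
    · simp
    · exact (hA.nat n hn).le
  have hsmall : ∀ q : F[X], (∀ k, w (q.coeff k) < 1) → ∀ y, w y ≤ 1 → w (q.eval y) < 1 := by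
    intro q hq y hy
    rw [eval_eq_sum]
    refine w.map_sum_lt one_ne_zero fun n _ => ?_
    rw [map_mul, map_pow]
    exact mul_lt_one_of_lt_of_le (hq n) (pow_le_one' hy n)
  have hp : p = R + (C (p.coeff 0) + X) := by rw [hR]; ring
  have hy0 : w (-p.coeff 0) ≤ 1 := by rwa [Valuation.map_neg]
  have hder : p.derivative = derivative R + 1 := by
    rw [hR]
    simp
  obtain ⟨r, hr, hr'⟩ := hA.hensel p hcoeff (-p.coeff 0) hy0
    (by
      have : p.eval (-p.coeff 0) = R.eval (-p.coeff 0) := by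
        rw [congrArg (eval (-p.coeff 0)) hp]
        simp only [eval_add, eval_C, eval_X]
        ring
      rw [this]
      exact hsmall R hRc _ hy0)
    (by
      rw [hder, eval_add, eval_one]
      have : w ((derivative R).eval (-p.coeff 0)) < 1 := hsmall _ (fun k => by
        rw [coeff_derivative, map_mul]
        have := hnat (k + 1)
        push_cast at this
        exact mul_lt_one_of_lt_of_le (hRc _) this) _ hy0
      rw [w.map_add_eq_of_lt_right (by rwa [map_one]), map_one])
  refine ⟨r, ?_, hr⟩
  rw [← sub_add_cancel r (-p.coeff 0)]
  exact w.map_add_le hr'.le hy0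

end

section

variable {F : Type*} [Field F] {Γ : Type*} [LinearOrderedCommGroupWithZero Γ]
variable {w : Valuation F Γ} {γ : Γ}
variable {E : Type*} [Field E] {ΓE : Type*} [LinearOrderedCommGroupWithZero ΓE]
variable {v : Valuation E ΓE} {i : E →+* F} {a : ℕ → E}

theorem IsPseudoCauchy.eq_one_of_taylorDominates (ha : IsPseudoCauchy v a)
    (hnat : ∀ n : ℕ, n ≠ 0 → v (n : E) = 1) {g : E[X]} {k : ℕ} (hk : 1 ≤ k) {β : ΓE} (hβ : β ≠ 0)
    (hst : StabilizesAlong v a (hasseDeriv 1 g))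
    (hev : ∀ᶠ n in atTop, v ((hasseDeriv k g).eval (a n)) = β ∧ TaylorDominates v a g k n) :
    k = 1 := by
  by_contra hk1
  have hcomp : ∀ l n, v ((hasseDeriv l (hasseDeriv 1 g)).eval (a n)) =
      v ((hasseDeriv (l + 1) g).eval (a n)) := by
    intro l n
    have : hasseDeriv l (hasseDeriv 1 g) = (l + 1) • hasseDeriv (l + 1) g := by
      have := LinearMap.congr_fun (hasseDeriv_comp (R := E) l 1) g
      rw [Nat.choose_symm_add, Nat.choose_one_right] at this
      exact this
    rw [this, eval_smul, nsmul_eq_mul, map_mul, hnat _ (by omega), one_mul]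
  obtain ⟨β₁, hβ₁⟩ := hst
  obtain ⟨n, ⟨⟨hn1, hn2⟩, hn3⟩, hn4⟩ :=
    ((hev.and hβ₁).and ((tendsto_add_atTop_nat 1).eventually hβ₁)).exists
  have hpos := ha.pos n
  have hdom : TaylorDominates v a (hasseDeriv 1 g) (k - 1) n := by
    intro l hl hlk
    have := hn2 (l + 1) (by omega) (by omega)
    rw [hcomp, hcomp, Nat.sub_add_cancel hk]
    rw [show k = k - 1 + 1 by omega, pow_succ, pow_succ, ← mul_assoc, ← mul_assoc,
      mul_lt_mul_iff_left₀ hpos] at this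
    simpa [Nat.sub_add_cancel hk] using this
  have hk0 : (hasseDeriv (k - 1) (hasseDeriv 1 g)).eval (a n) ≠ 0 := by
    rw [← Valuation.ne_zero_iff v, hcomp, Nat.sub_add_cancel hk, hn1]
    exact hβ
  have h1 := hdom.eval_sub ha (by omega) hk0 (Nat.lt_succ_self n)
  have h2 := hn2 1 le_rfl (Ne.symm hk1)
  rw [show k = k - 1 + 1 by omega, pow_one, pow_succ, ← mul_assoc,
    mul_lt_mul_iff_left₀ hpos, Nat.sub_add_cancel hk] at h2
  rw [hcomp, Nat.sub_add_cancel hk] at h1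
  rw [← h1, hn3] at h2
  exact h2.not_ge (v.map_sub_le hn4.le hn3.le)

theorem LaurentLike.exists_root_of_not_stabilizes (hA : LaurentLike w γ)
    (hE : v.IsEquiv (w.comap i)) (ha : IsPseudoCauchy v a) {g : E[X]}
    (hmin : ∀ h : E[X], h.natDegree < g.natDegree → StabilizesAlong v a h)
    (hg : ¬ StabilizesAlong v a g) : ∃ r, g.eval₂ i r = 0 ∧ IsPseudoLimit w i a r := by
  have hnat : ∀ n : ℕ, n ≠ 0 → v (n : E) = 1 := fun n hn => by
    refine hE.eq_one_iff_eq_one.2 ?_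
    rw [Valuation.comap_apply, map_natCast]
    exact hA.nat n hn
  have hdeg : g.natDegree ≠ 0 := by
    intro h0
    obtain ⟨c, rfl⟩ := natDegree_eq_zero.1 h0
    exact hg ⟨v c, by simp⟩
  have hg0 : g ≠ 0 := by
    rintro rfl
    simp at hdeg
  have hst : ∀ l, 1 ≤ l → StabilizesAlong v a (hasseDeriv l g) := fun l hl =>
    hmin _ ((natDegree_hasseDeriv_le g l).trans_lt (by omega))
  obtain ⟨k, hk, β, hβ, hev⟩ := ha.exists_taylorDominates hdeg hst
  obtain rfl := ha.eq_one_of_taylorDominates hnat hk hβ (hst 1 le_rfl) hev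
  obtain ⟨N, hN⟩ := eventually_atTop.1 hev
  have hk0 : ∀ n ≥ N, (hasseDeriv 1 g).eval (a n) ≠ 0 := fun n hn h0 => by
    have := (hN n hn).1
    rw [h0, map_zero] at this
    exact hβ this.symm
  have hle : ∀ n ≥ N, v (g.eval (a n)) ≤
      v ((hasseDeriv 1 g).eval (a n)) * v (a (n + 1) - a n) := by
    intro n hn
    by_contra! hlt
    refine hg ⟨v (g.eval (a n)), eventually_atTop.2 ⟨n, fun m hm => ?_⟩⟩
    rcases hm.lt_or_eq with hm | rfl
    · have := (hN n hn).2.eval_sub ha le_rfl (hk0 n hn) hm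
      rw [pow_one] at this
      refine v.map_eq_of_sub_lt ?_
      rwa [this]
    · rfl
  have hroot : ∀ n, ∃ r, g.eval₂ i r = 0 ∧ ∀ m < N + n,
      w (r - i (a m)) = w (i (a (m + 1) - a m)) := by
    suffices key : ∀ n, N ≤ n → ∃ r, g.eval₂ i r = 0 ∧
        w (r - i (a n)) ≤ w (i (a (n + 1) - a n)) by
      intro n
      obtain ⟨r, hr, hr'⟩ := key (N + n) (by omega)
      refine ⟨r, hr, fun m hm => ?_⟩
      have h1 : w (i (a (N + n)) - i (a m)) = w (i (a (m + 1) - a m)) := by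
        rw [← map_sub]
        exact hE.eq_iff.1 (ha.eq m (N + n) hm)
      have h2 : w (i (a (N + n + 1) - a (N + n))) < w (i (a (m + 1) - a m)) :=
        hE.lt_iff_lt.1 (ha.anti hm)
      rw [← sub_add_sub_cancel r (i (a (N + n))) (i (a m)), w.map_add_eq_of_lt_right, h1]
      rw [h1]
      exact hr'.trans_lt h2
    intro n hn
    set δ := a (n + 1) - a n with hδ
    set s := (hasseDeriv 1 g).eval (a n) * δ with hs
    have hvδ : 0 < v δ := ha.pos n
    have hδ0 : δ ≠ 0 := (Valuation.ne_zero_iff v).1 hvδ.ne'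
    have hs0 : s ≠ 0 := mul_ne_zero (hk0 n hn) hδ0
    have hvs : 0 < v s := zero_lt_iff.2 ((Valuation.ne_zero_iff v).2 hs0)
    let q : E[X] := C s⁻¹ * (taylor (a n) g).comp (C δ * X)
    have hq : ∀ l, q.coeff l = s⁻¹ * ((hasseDeriv l g).eval (a n) * δ ^ l) := by
      intro l
      simp [q, coeff_C_mul, comp_C_mul_X_coeff, taylor_coeff]
    have hvq : ∀ l, v (q.coeff l) = v ((hasseDeriv l g).eval (a n)) * v δ ^ l / v s := by
      intro l
      rw [hq, map_mul, map_inv₀, map_mul _ _ (δ ^ l), map_pow, div_eq_inv_mul]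
    obtain ⟨y, hy, hy0⟩ := hA.exists_eval_eq_zero (q.map i)
      (by
        rw [coeff_map]
        refine hE.le_one_iff_le_one.1 ?_
        rw [hvq, div_le_one₀ hvs, hasseDeriv_zero', pow_zero, mul_one, hs, map_mul]
        exact hle n hn)
      (by rw [coeff_map, hq, pow_one, ← hs, inv_mul_cancel₀ hs0, map_one])
      (by
        intro l hl
        rw [coeff_map]
        refine hE.lt_one_iff_lt_one.1 ?_
        rw [hvq, div_lt_one₀ hvs, hs, map_mul]
        simpa using (hN n hn).2 l (by omega) (by omega))
    refine ⟨i δ * y + i (a n), ?_, ?_⟩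
    · have h1 : (q.map i).eval y = i s⁻¹ * (g.map i).eval (i δ * y + i (a n)) := by
        simp only [q, Polynomial.map_mul, map_comp, map_taylor, map_C, map_X, eval_mul, eval_C,
          eval_comp, eval_X, taylor_eval]
      rw [h1, eval_map] at hy0
      rcases mul_eq_zero.1 hy0 with h | h
      · simp [hs0] at h
      · exact h
    · rw [add_sub_cancel_right, map_mul]
      exact mul_le_of_le_one_right' hy
  choose r hr hr' using hroot
  have hg' : g.map i ≠ 0 := (Polynomial.map_ne_zero_iff i.injective).2 hg0
  obtain ⟨⟨y, hy⟩, hinf⟩ := Finite.exists_infinite_fiber fun n => (⟨r n, by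
    rw [mem_rootSet_of_ne hg']
    simpa [eval₂_eq_eval_map] using hr n⟩ : (g.map i).rootSet F)
  have hinf' := Set.infinite_coe_iff.1 hinf
  refine ⟨y, ?_, fun m => ?_⟩
  · rw [mem_rootSet_of_ne hg'] at hy
    simpa [eval₂_eq_eval_map] using hy
  · obtain ⟨n, hn, hmn⟩ := hinf'.exists_gt m
    have : r n = y := congrArg Subtype.val hn
    rw [← this]
    exact hr' n m (by omega)

variable {j : E →+* F}

/-- If `E` is algebraically maximal, polynomials stabilize along pseudo-Cauchy sequences without
pseudo-limit in `E`. -/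
theorem AlgMaximal.stabilizesAlong (hA : LaurentLike w γ) (hS : SameVal w γ i j)
    (hM : AlgMaximal w i j) (ha : IsPseudoCauchy (w.comap i) a)
    (hlim : ∀ e, ¬ IsPseudoLimit w i a (i e)) (h : E[X]) : StabilizesAlong (w.comap i) a h := by
  classical
  by_contra hcon
  have hex : ∃ d, ∃ g : E[X], g.natDegree = d ∧ ¬ StabilizesAlong (w.comap i) a g := ⟨_, h, rfl, hcon⟩
  obtain ⟨f, hfd, hf⟩ := Nat.find_spec hex
  have hmin' : ∀ h : E[X], h.natDegree < f.natDegree → StabilizesAlong (w.comap i) a h := by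
    intro h hh
    by_contra hns
    exact Nat.find_min hex (hfd ▸ hh) ⟨h, rfl, hns⟩
  have hf0 : f ≠ 0 := by
    rintro rfl
    exact hf ⟨0, by simp⟩
  have hlc : f.leadingCoeff⁻¹ ≠ 0 := inv_ne_zero (leadingCoeff_ne_zero.2 hf0)
  obtain ⟨g, hgm, hgd, hg⟩ : ∃ g : E[X], g.Monic ∧ g.natDegree = f.natDegree ∧
      ¬ StabilizesAlong (w.comap i) a g := by
    refine ⟨C f.leadingCoeff⁻¹ * f, ?_, natDegree_C_mul hlc, ?_⟩
    · rw [mul_comm]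
      exact monic_mul_leadingCoeff_inv hf0
    · rintro ⟨β, hβ⟩
      refine hf ⟨(w.comap i) f.leadingCoeff * β, hβ.mono fun n hn => ?_⟩
      rw [← hn, ← map_mul, eval_mul, eval_C, mul_inv_cancel_left₀ (leadingCoeff_ne_zero.2 hf0)]
  rw [← hgd] at hmin'
  have hEi : (w.comap i).IsEquiv (w.comap i) := Valuation.IsEquiv.refl
  obtain ⟨r, hr, hrl⟩ := hA.exists_root_of_not_stabilizes hEi ha hmin' hg
  obtain ⟨r', hr', hrl'⟩ := hA.exists_root_of_not_stabilizes hS.isEquiv ha hmin' hg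
  have hg1 : g ≠ 1 := by
    rintro rfl
    exact hg ⟨1, by simp⟩
  have hcompat : Compat w i j r r' := by
    refine Compat.of_eq hS fun h => ?_
    have hst : ∀ l, StabilizesAlong (w.comap i) a (hasseDeriv l (h %ₘ g)) := fun l =>
      hmin' _ (((natDegree_hasseDeriv_le _ l).trans (Nat.sub_le _ _)).trans_lt
        (natDegree_modByMonic_lt _ hgm hg1))
    obtain ⟨n, h1, h2⟩ := ((ha.eval₂_eq hEi hst hrl).and (ha.eval₂_eq hS.isEquiv hst hrl')).exists
    refine ⟨(h %ₘ g).eval (a n), ?_, ?_⟩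
    · rw [← h1, eval₂_modByMonic_eq_self_of_root hr]
    · rw [← h2, eval₂_modByMonic_eq_self_of_root hr']
  obtain ⟨e, rfl⟩ := hM r r' ⟨g, hgm.ne_zero, hr⟩ hcompat
  exact hlim e hrl

end

section

variable {F : Type*} [Field F] {Γ : Type*} [LinearOrderedCommGroupWithZero Γ]
variable {w : Valuation F Γ} {γ : Γ}

/-- The basic conditions on one element of a valued field used in the back-and-forth argument. -/
inductive BasicCondition (w : Valuation F Γ) : (F → Prop) → Prop
  | near (b c : F) : BasicCondition w fun z => w (z - b) = w c
  | lt (e : F) : BasicCondition w fun z => w z < w e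
  | gt (e : F) : BasicCondition w fun z => w e < w z
  | pow (e : F) (m n : ℕ) : BasicCondition w fun z => IsPowVal w n (e * z ^ m)
  | not_pow (e : F) (m n : ℕ) : BasicCondition w fun z => ¬ IsPowVal w n (e * z ^ m)

/-- Countable saturation with respect to the basic conditions. -/
def IsBasicSaturated (w : Valuation F Γ) : Prop :=
  ∀ Q : ℕ → F → Prop, (∀ k, BasicCondition w (Q k)) → (∀ J, ∃ z, ∀ k ≤ J, Q k z) →
    ∃ z, ∀ k, Q k z

theorem IsBasicSaturated.exists_forall (hw : IsBasicSaturated w) {ι : Type*} [Countable ι]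
    [Nonempty ι] (Q : ι → F → Prop) (hQ : ∀ k, BasicCondition w (Q k))
    (hfin : ∀ s : Finset ι, ∃ z, ∀ k ∈ s, Q k z) : ∃ z, ∀ k, Q k z := by
  classical
  obtain ⟨f, hf⟩ := exists_surjective_nat ι
  obtain ⟨z, hz⟩ := hw (fun k => Q (f k)) (fun k => hQ _) fun J => by
    obtain ⟨z, hz⟩ := hfin ((Finset.range (J + 1)).image f)
    exact ⟨z, fun k hk => hz _ (Finset.mem_image_of_mem f (by simp; omega))⟩
  exact ⟨z, hf.forall.2 hz⟩

variable {E : Type*} [Field E] {i j : E →+* F}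

theorem Compat.comp {x x' : F} (h : Compat w i j x x') (q : E[X]) :
    Compat w i j (q.eval₂ i x) (q.eval₂ j x') := by
  refine ⟨fun g k => ?_, fun g n hn => ?_⟩
  · simpa only [eval₂_comp] using h.le_iff (g.comp q) (k.comp q)
  · simpa only [eval₂_comp] using h.pow_iff (g.comp q) n hn

theorem Compat.of_mem_range (hS : SameVal w γ i j) (e : E) : Compat w i j (i e) (j e) :=
  Compat.of_eq hS fun g => ⟨g.eval e, by rw [eval₂_at_apply], by rw [eval₂_at_apply]⟩

/-- The immediate case of the back-and-forth step. -/
theorem exists_compat_of_immediate [Countable E] (hA : LaurentLike w γ) (hw : IsBasicSaturated w)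
    (hS : SameVal w γ i j) (hM : AlgMaximal w i j) {x : F}
    (hx : ∀ a, ∃ a', w (x - i a') < w (x - i a)) : ∃ x', Compat w i j x x' := by
  obtain ⟨e, he⟩ := exists_surjective_nat E
  have hstep : ∀ a b, ∃ a', w (x - i a') < w (x - i a) ∧ w (x - i a') < w (x - i b) := by
    intro a b
    rcases le_total (w (x - i a)) (w (x - i b)) with h | h
    · obtain ⟨a', ha'⟩ := hx a
      exact ⟨a', ha', ha'.trans_le h⟩
    · obtain ⟨a', ha'⟩ := hx b
      exact ⟨a', ha'.trans_le h, ha'⟩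
  choose f hf₁ hf₂ using hstep
  let a : ℕ → E := fun n => Nat.rec 0 (fun n an => f an (e n)) n
  have ha₁ : ∀ n, w (x - i (a (n + 1))) < w (x - i (a n)) := fun n => hf₁ _ _
  have ha₂ : ∀ n, w (x - i (a (n + 1))) < w (x - i (e n)) := fun n => hf₂ _ _
  have hanti : StrictAnti fun n => w (x - i (a n)) := strictAnti_nat_of_succ_lt ha₁
  have hdiff : ∀ n m, n < m → w (i (a m - a n)) = w (x - i (a n)) := by
    intro n m hnm
    rw [map_sub, ← sub_sub_sub_cancel_left _ _ x]
    exact w.map_sub_eq_of_lt_left (hanti hnm)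
  have hpc : IsPseudoCauchy (w.comap i) a := by
    refine ⟨fun n m hnm => ?_, ?_⟩
    · exact (hdiff n m hnm).trans (hdiff n (n + 1) n.lt_succ_self).symm
    · have : (fun n => (w.comap i) (a (n + 1) - a n)) = fun n => w (x - i (a n)) := by
        ext n
        exact hdiff n (n + 1) n.lt_succ_self
      rw [this]
      exact hanti
  have hxl : IsPseudoLimit w i a x := fun n => (hdiff n (n + 1) n.lt_succ_self).symm
  have hst := hM.stabilizesAlong hA hS hpc (by
    intro c hc
    obtain ⟨n, rfl⟩ := he c
    refine (ha₂ n).not_ge ?_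
    rw [← sub_sub_sub_cancel_right _ _ (i (a (n + 1)))]
    refine w.map_sub_le le_rfl ?_
    rw [hc (n + 1)]
    exact (hdiff (n + 1) (n + 2) (Nat.lt_succ_self _)).le)
  obtain ⟨x', hx'⟩ := hw (fun n z => w (z - j (a n)) = w (j (a (n + 1) - a n)))
    (fun n => .near _ _) fun J => ⟨j (a (J + 1)), fun n hn => by
      rw [← map_sub]
      exact (hS.eq_iff _ _).1 (hpc.eq n (J + 1) (by omega))⟩
  refine ⟨x', Compat.of_eq hS fun g => ?_⟩
  obtain ⟨n, h1, h2⟩ := ((hpc.eval₂_eq Valuation.IsEquiv.refl (fun l => hst (hasseDeriv l g))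
    hxl).and (hpc.eval₂_eq hS.isEquiv (fun l => hst (hasseDeriv l g)) hx')).exists
  exact ⟨_, h1, h2⟩

theorem Compat.of_generic_residue (hS : SameVal w γ i j)
    (hR : ∀ d, HasApproxRoots (w.comap i) d) {u u' : F} (hu : ∀ e, w (i e) ≤ 1 → w (u - i e) = 1)
    (hu' : ∀ e, w (i e) ≤ 1 → w (u' - j e) = 1) : Compat w i j u u' := by
  refine Compat.of_eq hS fun g => ?_
  obtain ⟨k, hk⟩ := Polynomial.exists_coeff_max (w.comap i) g
  refine ⟨g.coeff k, ?_, ?_⟩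
  · exact (hR (g.natDegree + 1)).eval₂_eq Valuation.IsEquiv.refl
      (by simpa using (hu 0 (by simp)).le) hu (Nat.lt_succ_self _) hk
  · exact (hR (g.natDegree + 1)).eval₂_eq hS.isEquiv
      (by simpa using (hu' 0 (by simp)).le) hu' (Nat.lt_succ_self _) hk

/-- The residual case of the back-and-forth step. -/
theorem exists_compat_of_residual [Countable E] (hA : LaurentLike w γ) (hw : IsBasicSaturated w)
    (hS : SameVal w γ i j) (hM : AlgMaximal w i j) {u : F}
    (hu : ∀ e, w (i e) ≤ 1 → w (u - i e) = 1) : ∃ u', Compat w i j u u' := by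
  classical
  have : Nonempty {e : E // w (i e) ≤ 1} := ⟨0, by simp⟩
  obtain ⟨u', hu'⟩ := hw.exists_forall (ι := {e : E // w (i e) ≤ 1})
    (fun e z => w (z - j e) = w (1 : F)) (fun e => .near _ _) (by
      intro s
      have hfin : (⋃ e ∈ s, {n : ℕ | w ((n : F) - j e) < 1}).Finite := by
        refine s.finite_toSet.biUnion fun e _ => Set.Subsingleton.finite ?_
        have key : ∀ n m : ℕ, w ((n : F) - j e) < 1 → w ((m : F) - j e) < 1 → ¬ n < m := by
          intro n m hn hm hnm
          have h1 := w.map_sub_lt hm hn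
          rw [sub_sub_sub_cancel_right, ← Nat.cast_sub hnm.le, hA.nat _ (by omega)] at h1
          exact h1.false
        intro n hn m hm
        exact le_antisymm (not_lt.1 (key m n hm hn)) (not_lt.1 (key n m hn hm))
      obtain ⟨n, hn⟩ := hfin.exists_notMem
      refine ⟨(n : F), fun e he => ?_⟩
      rw [map_one]
      refine le_antisymm (w.map_sub_le ?_ ?_) (not_lt.1 fun h => hn ?_)
      · rcases eq_or_ne n 0 with rfl | h0
        · simp
        · exact (hA.nat n h0).le
      · have := (hS.le_iff e.1 1).1
        simp only [map_one] at this
        exact this e.2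
      · exact Set.mem_biUnion he h)
  exact ⟨u', Compat.of_generic_residue hS (hM.hasApproxRoots hA hS) hu fun e he =>
    (hu' ⟨e, he⟩).trans (map_one w)⟩

end

section

variable {F : Type*} [Field F] {Γ : Type*} [LinearOrderedCommGroupWithZero Γ]
variable {w : Valuation F Γ} {γ : Γ}
variable {E : Type*} [Field E] {i j : E →+* F}

theorem LaurentLike.lt_mul_unif (hA : LaurentLike w γ) {y : F} (hy : ∀ e, w y ≠ w (i e)) {t c : E}
    (ht : w (i t) = γ) (h : w y < w (i c)) : w y < w (i (c * t)) := by
  have hc : w (i c) ≠ 0 := ((zero_le).trans_lt h).ne'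
  refine lt_of_le_of_ne ?_ (hy _)
  have h1 : w (y / i c) < 1 := by
    rw [map_div₀]
    exact (div_lt_one₀ (zero_lt_iff.2 hc)).2 h
  have h2 := hA.le_of_lt_one _ h1
  rw [map_div₀, div_le_iff₀ (zero_lt_iff.2 hc), mul_comm, ← ht, ← map_mul, ← map_mul] at h2
  exact h2

theorem LaurentLike.div_unif_pow_lt (hA : LaurentLike w γ) {y : F} (hy : ∀ e, w y ≠ w (i e))
    {t c : E} (ht : w (i t) = γ) (h : w (i c) < w y) (k : ℕ) : w (i (c / t ^ k)) < w y := by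
  have ht0 : t ≠ 0 := by
    rintro rfl
    exact hA.ne_zero (by simpa using ht.symm)
  induction k with
  | zero => simpa using h
  | succ k ih =>
    refine lt_of_le_of_ne (not_lt.1 fun h' => ?_) (hy _).symm
    have := hA.lt_mul_unif hy ht h'
    rw [show c / t ^ (k + 1) * t = c / t ^ k by field_simp; ring] at this
    exact this.not_gt ih

theorem AlgMaximal.exists_unif_pow (hA : LaurentLike w γ) (hS : SameVal w γ i j)
    (hM : AlgMaximal w i j) {t : E} (ht : w (i t) = γ) {N : ℕ} (hN : 0 < N) (e : E) :
    ∃ r < N, ∃ c : E, w (i e) = w (i (t ^ r * c ^ N)) := by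
  have hγ : w (i t) ≠ 0 := by
    rw [ht]
    exact hA.ne_zero
  obtain ⟨r, hr, z, hz⟩ := hA.zgrp N hN.ne' (i e) (i t) ht
  obtain ⟨c, hc⟩ := hM.exists_pow_eq hA hS hN (a := e / t ^ r) (z := z) (by
    rw [map_div₀, map_div₀, hz, map_pow, map_pow, mul_div_cancel_left₀ _ (pow_ne_zero _ hγ)])
  refine ⟨r, hr, c, ?_⟩
  simp only [map_mul, map_pow, hc, hz]

theorem AlgMaximal.pow_cut (hA : LaurentLike w γ) (hS : SameVal w γ i j)
    (hM : AlgMaximal w i j) {y y' : F} (hy : ∀ e, w y ≠ w (i e))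
    (hcut : ∀ e, (w y < w (i e) → w y' < w (j e)) ∧ (w (i e) < w y → w (j e) < w y'))
    {N : ℕ} (hN : 0 < N) (e : E) :
    (w y ^ N < w (i e) → w y' ^ N < w (j e)) ∧ (w (i e) < w y ^ N → w (j e) < w y' ^ N) := by
  obtain ⟨t, ht, ht'⟩ := hS.unif
  obtain ⟨r, hr, c, hc⟩ := hM.exists_unif_pow hA hS ht hN e
  have hc' := (hS.eq_iff _ _).1 hc
  rw [hc, hc']
  have hγ := hA.lt_one.le
  simp only [map_mul, map_pow, ht, ht']
  constructor
  · intro h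
    have h1 : w y < w (i c) := by
      refine lt_of_pow_lt_pow_left₀ N zero_le (h.trans_le ?_)
      exact mul_le_of_le_one_left' (pow_le_one₀ zero_le hγ)
    have h2 := (hcut _).1 (hA.lt_mul_unif hy ht h1)
    have h3 := pow_lt_pow_left₀ h2 zero_le hN.ne'
    refine h3.trans_le ?_
    rw [map_mul, map_mul, mul_pow, ht', mul_comm]
    exact mul_le_mul_left (pow_le_pow_of_le_one zero_le hγ hr.le) _
  · intro h
    have h1 : w (i c) < w y := by
      refine lt_of_le_of_ne (not_lt.1 fun h' => ?_) (hy _).symm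
      have h2 := pow_lt_pow_left₀ (hA.lt_mul_unif hy ht h') zero_le hN.ne'
      rw [map_mul, map_mul, mul_pow, ht, mul_comm] at h2
      refine (h.trans h2).not_ge ?_
      exact mul_le_mul_left (pow_le_pow_of_le_one zero_le hγ hr.le) _
    refine lt_of_le_of_lt ?_ (pow_lt_pow_left₀ ((hcut _).2 h1) zero_le hN.ne')
    exact mul_le_of_le_one_left' (pow_le_one₀ zero_le hγ)

theorem Compat.of_generic_value (hA : LaurentLike w γ) (hS : SameVal w γ i j)
    (hM : AlgMaximal w i j) {y y' : F} (hy : ∀ e, w y ≠ w (i e))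
    (hcut : ∀ e, (w y < w (i e) → w y' < w (j e)) ∧ (w (i e) < w y → w (j e) < w y'))
    (hpow : ∀ (a : E) (m n : ℕ), 0 < n →
      (IsPowVal w n (i a * y ^ m) ↔ IsPowVal w n (j a * y' ^ m))) : Compat w i j y y' := by
  have hy0 : 0 < w y := by
    rw [zero_lt_iff]
    simpa using hy 0
  have hy0' : 0 < w y' := by simpa using (hcut 0).2 (by simpa using hy0)
  have hne : ∀ N, 0 < N → ∀ e, w y ^ N ≠ w (i e) := by
    intro N hN e h
    obtain ⟨c, hc⟩ := hM.exists_pow_eq hA hS hN h.symm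
    exact hy c hc.symm
  have hcore : ∀ N, 0 < N → ∀ e, (w y ^ N ≤ w (i e) ↔ w y' ^ N ≤ w (j e)) ∧
      (w (i e) ≤ w y ^ N ↔ w (j e) ≤ w y' ^ N) := by
    intro N hN e
    obtain ⟨h1, h2⟩ := hM.pow_cut hA hS hy hcut hN e
    rcases lt_or_gt_of_ne (hne N hN e) with h | h
    · exact ⟨iff_of_true h.le (h1 h).le, iff_of_false h.not_ge (h1 h).not_ge⟩
    · exact ⟨iff_of_false h.not_ge (h2 h).not_ge, iff_of_true h.le (h2 h).le⟩
  have hle : ∀ (a b : E) (m n : ℕ),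
      w (i a * y ^ m) ≤ w (i b * y ^ n) ↔ w (j a * y' ^ m) ≤ w (j b * y' ^ n) := by
    intro a b m n
    simp only [map_mul, map_pow]
    rcases le_total m n with hmn | hmn
    · obtain ⟨k, rfl⟩ := Nat.exists_eq_add_of_le hmn
      rw [add_comm m k, pow_add, pow_add, ← mul_assoc, ← mul_assoc,
        mul_le_mul_iff_left₀ (pow_pos hy0 m), mul_le_mul_iff_left₀ (pow_pos hy0' m)]
      rcases Nat.eq_zero_or_pos k with rfl | hk
      · simpa using hS.le_iff a b
      rcases eq_or_ne b 0 with rfl | hb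
      · simp
      have hb1 : 0 < w (i b) := zero_lt_iff.2 ((Valuation.ne_zero_iff _).2 (by simpa using hb))
      have hb2 : 0 < w (j b) := zero_lt_iff.2 ((Valuation.ne_zero_iff _).2 (by simpa using hb))
      have := (hcore k hk (a / b)).2
      simpa only [map_div₀, div_le_iff₀' hb1, div_le_iff₀' hb2] using this
    · obtain ⟨k, rfl⟩ := Nat.exists_eq_add_of_le hmn
      rw [add_comm n k, pow_add, pow_add, ← mul_assoc, ← mul_assoc,
        mul_le_mul_iff_left₀ (pow_pos hy0 n), mul_le_mul_iff_left₀ (pow_pos hy0' n)]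
      rcases Nat.eq_zero_or_pos k with rfl | hk
      · simpa using hS.le_iff a b
      rcases eq_or_ne a 0 with rfl | ha
      · simp
      have ha1 : 0 < w (i a) := zero_lt_iff.2 ((Valuation.ne_zero_iff _).2 (by simpa using ha))
      have ha2 : 0 < w (j a) := zero_lt_iff.2 ((Valuation.ne_zero_iff _).2 (by simpa using ha))
      have := (hcore k hk (b / a)).1
      simpa only [map_div₀, le_div_iff₀' ha1, le_div_iff₀' ha2] using this
  refine Compat.of_monomial hle hpow fun g => ?_
  obtain ⟨k, h1, h2⟩ := exists_monomial_eq hle g (by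
    intro a b ha hb k l hkl hl heq
    obtain ⟨r, rfl⟩ := Nat.exists_eq_add_of_lt hkl
    rw [show k + r + 1 = (r + 1) + k by ring, pow_add, ← mul_assoc, map_mul, map_mul] at heq
    have h1 := mul_right_cancel₀ (by simpa using (pow_pos hy0 k).ne') heq
    have hb' : w (i b) ≠ 0 := (Valuation.ne_zero_iff _).2 (by simpa using hb)
    refine hne (r + 1) (Nat.succ_pos r) (a / b) ?_
    rw [map_div₀, map_div₀, h1, map_mul, mul_div_cancel_left₀ _ hb', map_pow])
  exact ⟨g.coeff k, k, h1, h2⟩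

theorem LaurentLike.exists_approx_value (hA : LaurentLike w γ) {t : E} (ht : w (i t) = γ)
    {y : F} (hy : ∀ e, w y ≠ w (i e)) (T : Finset E) {N : ℕ} (hN : 0 < N) :
    ∃ y₀ : E, y₀ ≠ 0 ∧ (∃ z, w y = w (i y₀) * w z ^ N) ∧
      ∀ e ∈ T, (w y < w (i e) → w (i y₀) < w (i e)) ∧ (w (i e) < w y → w (i e) < w (i y₀)) := by
  classical
  have hy0 : 0 < w y := by
    rw [zero_lt_iff]
    simpa using hy 0
  have ht0 : t ≠ 0 := by
    rintro rfl
    exact hA.ne_zero (by simpa using ht.symm)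
  have hγ0 : 0 < w (i t) := by
    rw [ht]
    exact zero_lt_iff.2 hA.ne_zero
  have hγ1 : w (i t) < 1 := by
    rw [ht]
    exact hA.lt_one
  have hpos : ∀ e : E, e ≠ 0 → 0 < w (i e) := fun e he =>
    zero_lt_iff.2 ((Valuation.ne_zero_iff _).2 (by simpa using he))
  by_cases hL : ((insert 1 T).filter fun e => e ≠ 0 ∧ w (i e) < w y).Nonempty
  · obtain ⟨l, hl, hmax⟩ := Finset.exists_max_image _ (fun e => w (i e)) hL
    simp only [Finset.mem_filter] at hl hmax
    obtain ⟨-, hl0, hly⟩ := hl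
    obtain ⟨r, hr, z, hz⟩ := hA.zgrp N hN.ne' (y / i l) (i t) ht
    obtain ⟨k, rfl⟩ := Nat.exists_eq_add_of_lt hr
    have hlk : w (i l) < w (i (l / t ^ (k + 1))) := by
      rw [map_div₀, map_div₀, map_pow, map_pow, lt_div_iff₀ (pow_pos hγ0 _)]
      exact mul_lt_of_lt_one_right (hpos _ hl0) (pow_lt_one₀ zero_le hγ1 (Nat.succ_ne_zero k))
    refine ⟨l / t ^ (k + 1), div_ne_zero hl0 (pow_ne_zero _ ht0), ⟨i t * z, ?_⟩, ?_⟩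
    · rw [map_div₀, div_eq_iff (hpos _ hl0).ne'] at hz
      rw [hz]
      simp only [map_div₀, map_mul, map_pow, mul_pow, pow_add]
      have := hγ0.ne'
      field_simp
    · intro e he
      refine ⟨(hA.div_unif_pow_lt hy ht hly _).trans, fun h => ?_⟩
      rcases eq_or_ne e 0 with rfl | he0
      · rw [map_zero, map_zero]
        exact zero_le.trans_lt hlk
      · exact (hmax e ⟨Finset.mem_insert_of_mem he, he0, h⟩).trans_lt hlk
  · rw [Finset.not_nonempty_iff_eq_empty, Finset.filter_eq_empty_iff] at hL
    have hL' : ∀ e ∈ insert 1 T, e ≠ 0 → w y < w (i e) := fun e he he0 =>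
      lt_of_le_of_ne (not_lt.1 fun h => hL he ⟨he0, h⟩) (hy e)
    obtain ⟨l, hl, hmin⟩ := Finset.exists_min_image ((insert 1 T).filter fun e => w y < w (i e))
      (fun e => w (i e)) ⟨1, by simpa using hL' 1 (Finset.mem_insert_self _ _) one_ne_zero⟩
    simp only [Finset.mem_filter] at hl hmin
    obtain ⟨-, hly⟩ := hl
    have hl0 : l ≠ 0 := by
      rintro rfl
      simp at hly
    obtain ⟨r, hr, z, hz⟩ := hA.zgrp N hN.ne' (y / i l) (i t) ht
    have h0 : l * t ^ (r + N) ≠ 0 := mul_ne_zero hl0 (pow_ne_zero _ ht0)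
    refine ⟨l * t ^ (r + N), h0, ⟨z / i t, ?_⟩, ?_⟩
    · rw [map_div₀, div_eq_iff (hpos _ hl0).ne'] at hz
      rw [hz]
      simp only [map_div₀, map_mul, map_pow, div_pow, pow_add]
      have := hγ0.ne'
      field_simp
    · intro e he
      refine ⟨fun h => ?_, fun h => ?_⟩
      · refine lt_of_lt_of_le ?_ (hmin e ⟨Finset.mem_insert_of_mem he, h⟩)
        rw [map_mul, map_mul, map_pow, map_pow]
        exact mul_lt_of_lt_one_right (hpos _ hl0) (pow_lt_one₀ zero_le hγ1 (by omega))
      · have : e = 0 := by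
          by_contra he0
          exact (hL' e (Finset.mem_insert_of_mem he) he0).not_gt h
        rw [this, map_zero, map_zero]
        exact hpos _ h0

theorem IsPowVal.mul_pow_congr {a x y z : F} {N m n : ℕ} (hn : n ∣ N) (hz : z ≠ 0)
    (h : w x = w y * w z ^ N) : IsPowVal w n (a * x ^ m) ↔ IsPowVal w n (a * y ^ m) := by
  obtain ⟨k, rfl⟩ := hn
  rw [← IsPowVal.mul_pow_iff (x := a * y ^ m) (pow_ne_zero (k * m) hz)]
  refine IsPowVal.congr ?_
  simp only [map_mul, map_pow, h, mul_pow, ← pow_mul, mul_assoc]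
  ring_nf

/-- The value-group case of the back-and-forth step. -/
theorem exists_compat_of_value [Countable E] (hA : LaurentLike w γ) (hw : IsBasicSaturated w)
    (hS : SameVal w γ i j) (hM : AlgMaximal w i j) {y : F} (hy : ∀ e, w y ≠ w (i e)) :
    ∃ y', Compat w i j y y' := by
  classical
  let Q : E ⊕ (E × ℕ × ℕ) → F → Prop
    | .inl e => if w y < w (i e) then fun z => w z < w (j e) else fun z => w (j e) < w z
    | .inr p => if IsPowVal w (p.2.2 + 1) (i p.1 * y ^ p.2.1)
        then fun z => IsPowVal w (p.2.2 + 1) (j p.1 * z ^ p.2.1)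
        else fun z => ¬ IsPowVal w (p.2.2 + 1) (j p.1 * z ^ p.2.1)
  have hQ : ∀ k, BasicCondition w (Q k) := by
    rintro (e | p)
    · simp only [Q]
      split_ifs
      exacts [.lt _, .gt _]
    · simp only [Q]
      split_ifs
      exacts [.pow _ _ _, .not_pow _ _ _]
  obtain ⟨y', hy'⟩ := hw.exists_forall Q hQ (by
    intro s
    obtain ⟨t, ht, -⟩ := hS.unif
    let f : E ⊕ (E × ℕ × ℕ) → ℕ := Sum.elim (fun _ => 1) fun p => p.2.2 + 1
    have hf : ∀ k, 0 < f k := by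
      rintro (e | p) <;> simp [f]
    obtain ⟨y₀, hy₀, ⟨z, hz⟩, hT⟩ := hA.exists_approx_value ht hy
      (s.image (Sum.elim id fun p => p.1)) (Finset.prod_pos fun k (_ : k ∈ s) => hf k)
    have hz0 : z ≠ 0 := by
      rintro rfl
      rw [map_zero, zero_pow (Finset.prod_pos fun k (_ : k ∈ s) => hf k).ne', mul_zero] at hz
      exact hy 0 (by simpa using hz)
    refine ⟨j y₀, fun k hk => ?_⟩
    rcases k with e | ⟨e, m, n⟩
    · have := hT e (Finset.mem_image.2 ⟨_, hk, rfl⟩)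
      simp only [Q]
      split_ifs with h
      · exact (hS.lt_iff _ _).1 (this.1 h)
      · exact (hS.lt_iff _ _).1 (this.2 (lt_of_le_of_ne (not_lt.1 h) (hy e).symm))
    · have h1 : IsPowVal w (n + 1) (i e * y ^ m) ↔ IsPowVal w (n + 1) (j e * j y₀ ^ m) := by
        rw [IsPowVal.mul_pow_congr (n := n + 1) (Finset.dvd_prod_of_mem f hk) hz0 hz]
        simpa using hS.pow_iff (e * y₀ ^ m) (n + 1) n.succ_pos
      simp only [Q]
      split_ifs with h
      · exact h1.1 h
      · exact fun h' => h (h1.2 h'))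
  refine ⟨y', Compat.of_generic_value hA hS hM hy (fun e => ⟨fun h => ?_, fun h => ?_⟩) ?_⟩
  · simpa [Q, h] using hy' (.inl e)
  · simpa [Q, h.not_gt] using hy' (.inl e)
  · intro a m n hn
    obtain ⟨n, rfl⟩ := Nat.exists_eq_succ_of_ne_zero hn.ne'
    have := hy' (.inr (a, m, n))
    by_cases h : IsPowVal w (n + 1) (i a * y ^ m)
    · simp only [Q, h, if_true] at this
      exact iff_of_true h this
    · simp only [Q, h, if_false] at this
      exact iff_of_false h this

/-- Every element can be adjoined to an algebraically maximal partial isomorphism. -/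
theorem AlgMaximal.exists_compat [Countable E] (hA : LaurentLike w γ) (hw : IsBasicSaturated w)
    (hS : SameVal w γ i j) (hM : AlgMaximal w i j) (x : F) : ∃ x', Compat w i j x x' := by
  by_cases hx : x ∈ Set.range i
  · obtain ⟨e, rfl⟩ := hx
    exact ⟨j e, Compat.of_mem_range hS e⟩
  by_cases him : ∀ a, ∃ a', w (x - i a') < w (x - i a)
  · exact exists_compat_of_immediate hA hw hS hM him
  push Not at him
  obtain ⟨a, ha⟩ := him
  by_cases hval : ∃ b, w (x - i a) = w (i b)
  · obtain ⟨b, hb⟩ := hval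
    have hxa : x - i a ≠ 0 := fun h => hx ⟨a, (sub_eq_zero.1 h).symm⟩
    have hb0 : i b ≠ 0 := by
      rw [← Valuation.ne_zero_iff w, ← hb]
      exact (Valuation.ne_zero_iff _).2 hxa
    have hb1 : w (i b) ≠ 0 := (Valuation.ne_zero_iff _).2 hb0
    obtain ⟨u', hu'⟩ := exists_compat_of_residual hA hw hS hM (u := (x - i a) / i b) (by
      intro e he
      have h1 : (x - i a) / i b - i e = (x - i (a + b * e)) / i b := by
        rw [map_add, map_mul]
        field_simp
        ring
      refine le_antisymm (w.map_sub_le ?_ he) ?_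
      · rw [map_div₀, hb, div_self hb1]
      · rw [h1, map_div₀, one_le_div₀ (zero_lt_iff.2 hb1), ← hb]
        exact ha _)
    have := hu'.comp (C b * X + C a)
    refine ⟨_, by simpa [mul_div_cancel₀ _ hb0] using this⟩
  · push Not at hval
    obtain ⟨y', hy'⟩ := exists_compat_of_value hA hw hS hM hval
    have := hy'.comp (X + C a)
    exact ⟨_, by simpa using this⟩

end

section

variable {F : Type u} [Field F] {Γ : Type*} [LinearOrderedCommGroupWithZero Γ]
variable {w : Valuation F Γ} {γ : Γ}

theorem IsPartialIso.exists_forth (hA : LaurentLike w γ) (hw : IsBasicSaturated w)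
    {G : Subring (F × F)} (hG : IsPartialIso w γ G) (x : F) :
    ∃ x', ∃ G₁, IsPartialIso w γ G₁ ∧ G ≤ G₁ ∧ (x, x') ∈ G₁ := by
  obtain ⟨E, _, _, i, j, hS, hM, hmem⟩ := hG.exists_algMaximal
  obtain ⟨x', hx'⟩ := hM.exists_compat hA hw hS x
  obtain ⟨G₁, h1, h2, h3, -⟩ := hx'.exists_partialIso hS
  refine ⟨x', G₁, h1, fun p hp => ?_, h3⟩
  obtain ⟨e, he1, he2⟩ := hmem p hp
  have := h2 e
  rwa [he1, he2] at this

theorem IsPartialIso.exists_back (hA : LaurentLike w γ) (hw : IsBasicSaturated w)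
    {G : Subring (F × F)} (hG : IsPartialIso w γ G) (x' : F) :
    ∃ x, ∃ G₁, IsPartialIso w γ G₁ ∧ G ≤ G₁ ∧ (x, x') ∈ G₁ := by
  obtain ⟨x, G₁, h1, h2, h3⟩ := hG.swap.exists_forth hA hw x'
  exact ⟨x, _, h1.swap, fun p hp => h2 (show p.swap ∈ _ from hp), h3⟩

end

section

variable {F : Type u} [Field F] {Γ : Type*} [LinearOrderedCommGroupWithZero Γ]
variable {w : Valuation F Γ} {γ : Γ}

theorem IsPartialIso.term_mem (G : Subring (F × F)) {β : Type*}
    (v : β → F × F) (hv : ∀ b, v b ∈ G) (t : LVR.Term β) :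
    letI : LVR.Structure F := valuedStructure w γ
    (t.realize (Prod.fst ∘ v), t.realize (Prod.snd ∘ v)) ∈ G := by
  letI : LVR.Structure F := valuedStructure w γ
  induction t with
  | var b => exact hv b
  | func f ts ih =>
    cases f with
    | zero => exact G.zero_mem
    | one => exact G.one_mem
    | add => exact G.add_mem (ih 0) (ih 1)
    | mul => exact G.mul_mem (ih 0) (ih 1)

theorem IsPartialIso.rel_iff (hA : LaurentLike w γ) {G : Subring (F × F)}
    (hG : IsPartialIso w γ G) {l : ℕ} (R : LVRRel l) (p : Fin l → F × F) (hp : ∀ b, p b ∈ G) :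
    LVRrel w γ R (Prod.fst ∘ p) ↔ LVRrel w γ R (Prod.snd ∘ p) := by
  cases R with
  | dvd => exact hG.le_iff _ (hp 1) _ (hp 0)
  | N =>
    obtain ⟨t, ht, h1, h2⟩ := hG.unif
    simp only [LVRrel, Function.comp_apply]
    nth_rewrite 1 [← h1]
    rw [← h2, le_antisymm_iff, le_antisymm_iff, hG.le_iff _ (hp 0) _ ht, hG.le_iff _ ht _ (hp 0)]
  | pow m =>
    have := hG.pow_iff _ (hp 0) m m.pos
    rwa [hA.isPowVal_iff m.pos, hA.isPowVal_iff m.pos] at this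

/-- Partial isomorphisms preserve all formulas. -/
theorem IsPartialIso.realize_iff (hA : LaurentLike w γ) (hw : IsBasicSaturated w) {α : Type*}
    {n : ℕ} (φ : LVR.BoundedFormula α n) {G : Subring (F × F)} (hG : IsPartialIso w γ G)
    (v : α → F × F) (hv : ∀ a, v a ∈ G) (xs : Fin n → F × F) (hxs : ∀ a, xs a ∈ G) :
    letI : LVR.Structure F := valuedStructure w γ
    φ.Realize (Prod.fst ∘ v) (Prod.fst ∘ xs) ↔ φ.Realize (Prod.snd ∘ v) (Prod.snd ∘ xs) := by
  letI : LVR.Structure F := valuedStructure w γ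
  have hterm : ∀ {n : ℕ} {G : Subring (F × F)} (_ : IsPartialIso w γ G)
      (_ : ∀ a, v a ∈ G) (xs : Fin n → F × F) (_ : ∀ a, xs a ∈ G) (t : LVR.Term (α ⊕ Fin n)),
      (t.realize (Sum.elim (Prod.fst ∘ v) (Prod.fst ∘ xs)),
        t.realize (Sum.elim (Prod.snd ∘ v) (Prod.snd ∘ xs))) ∈ G := by
    intro n G hG hv xs hxs t
    rw [← Sum.comp_elim, ← Sum.comp_elim]
    exact IsPartialIso.term_mem G _ (by rintro (a | a); exacts [hv a, hxs a]) t
  induction φ generalizing G with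
  | falsum => rfl
  | equal t₁ t₂ =>
    simp only [Language.BoundedFormula.Realize]
    have h1 := hterm hG hv xs hxs t₁
    have h2 := hterm hG hv xs hxs t₂
    have := hG.le_iff _ (G.sub_mem h1 h2) _ G.zero_mem
    simpa [sub_eq_zero] using this
  | rel R ts =>
    exact hG.rel_iff hA R (fun b => (_, _)) fun b => hterm hG hv xs hxs (ts b)
  | imp φ ψ ih₁ ih₂ => exact imp_congr (ih₁ hG hv xs hxs) (ih₂ hG hv xs hxs)
  | all φ ih =>
    simp only [Language.BoundedFormula.Realize]
    constructor
    · intro h x'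
      obtain ⟨x, G₁, hG₁, hle, hx⟩ := hG.exists_back hA hw x'
      have := (ih hG₁ (fun a => hle (hv a)) (Fin.snoc xs (x, x')) (by
        refine Fin.lastCases ?_ fun a => ?_
        · simpa using hx
        · simpa using hle (hxs a))).1
      simp only [Fin.comp_snoc] at this
      exact this (h x)
    · intro h x
      obtain ⟨x', G₁, hG₁, hle, hx⟩ := hG.exists_forth hA hw x
      have := (ih hG₁ (fun a => hle (hv a)) (Fin.snoc xs (x, x')) (by
        refine Fin.lastCases ?_ fun a => ?_
        · simpa using hx
        · simpa using hle (hxs a))).2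
      simp only [Fin.comp_snoc] at this
      exact this (h x')

end

section

variable {F : Type*} [Field F] {Γ : Type*} [LinearOrderedCommGroupWithZero Γ]

/-- The sum of two terms. -/
def LVR.addTerm {α : Type*} (s t : LVR.Term α) : LVR.Term α := .func LVRFunc.add ![s, t]

/-- The product of two terms. -/
def LVR.mulTerm {α : Type*} (s t : LVR.Term α) : LVR.Term α := .func LVRFunc.mul ![s, t]

/-- A term for a natural number. -/
def LVR.natTerm (α : Type*) : ℕ → LVR.Term α
  | 0 => .func LVRFunc.zero ![]
  | n + 1 => LVR.addTerm (LVR.natTerm α n) (.func LVRFunc.one ![])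

/-- A power of a term. -/
def LVR.powTerm {α : Type*} (t : LVR.Term α) : ℕ → LVR.Term α
  | 0 => LVR.natTerm α 1
  | n + 1 => LVR.mulTerm (LVR.powTerm t n) t

/-- A finite sum of terms. -/
def LVR.sumTerm {α : Type*} : (m : ℕ) → (Fin m → LVR.Term α) → LVR.Term α
  | 0, _ => LVR.natTerm α 0
  | m + 1, f => LVR.addTerm (LVR.sumTerm m fun k => f k.castSucc) (f (Fin.last m))

/-- The formula stating that the value of `s` is at most the value of `t`. -/
def LVR.leFormula {α : Type*} (s t : LVR.Term α) : LVR.Formula α :=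
  Language.Relations.formula (L := LVR) LVRRel.dvd ![t, s]

/-- The formula stating that `t` is a uniformizer. -/
def LVR.unifFormula {α : Type*} (t : LVR.Term α) : LVR.Formula α :=
  Language.Relations.formula (L := LVR) LVRRel.N ![t]

variable (w : Valuation F Γ) (γ : Γ) {α : Type*} (v : α → F)

@[simp]
theorem LVR.realize_addTerm (s t : LVR.Term α) :
    letI : LVR.Structure F := valuedStructure w γ
    (LVR.addTerm s t).realize v = s.realize v + t.realize v := rfl

@[simp]
theorem LVR.realize_mulTerm (s t : LVR.Term α) :
    letI : LVR.Structure F := valuedStructure w γ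
    (LVR.mulTerm s t).realize v = s.realize v * t.realize v := rfl

@[simp]
theorem LVR.realize_natTerm (n : ℕ) :
    letI : LVR.Structure F := valuedStructure w γ
    (LVR.natTerm α n).realize v = (n : F) := by
  let _ : LVR.Structure F := valuedStructure w γ
  induction n with
  | zero =>
    rw [Nat.cast_zero]
    rfl
  | succ n ih =>
    rw [Nat.cast_succ, ← ih]
    rfl

@[simp]
theorem LVR.realize_powTerm (t : LVR.Term α) (n : ℕ) :
    letI : LVR.Structure F := valuedStructure w γ
    (LVR.powTerm t n).realize v = t.realize v ^ n := by
  induction n with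
  | zero => simp [LVR.powTerm]
  | succ n ih => simp [LVR.powTerm, ih, pow_succ]

@[simp]
theorem LVR.realize_sumTerm (m : ℕ) (f : Fin m → LVR.Term α) :
    letI : LVR.Structure F := valuedStructure w γ
    (LVR.sumTerm m f).realize v = ∑ k, (f k).realize v := by
  induction m with
  | zero => simp [LVR.sumTerm]
  | succ n ih => simp [LVR.sumTerm, ih, Fin.sum_univ_castSucc]

@[simp]
theorem LVR.realize_leFormula (s t : LVR.Term α) :
    letI : LVR.Structure F := valuedStructure w γ
    (LVR.leFormula s t).Realize v ↔ w (s.realize v) ≤ w (t.realize v) := by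
  let _ : LVR.Structure F := valuedStructure w γ
  exact (Language.Formula.realize_rel (L := LVR) (R := LVRRel.dvd) (ts := ![t, s])).trans Iff.rfl

@[simp]
theorem LVR.realize_unifFormula (t : LVR.Term α) :
    letI : LVR.Structure F := valuedStructure w γ
    (LVR.unifFormula t).Realize v ↔ w (t.realize v) = γ := by
  let _ : LVR.Structure F := valuedStructure w γ
  exact (Language.Formula.realize_rel (L := LVR) (R := LVRRel.N) (ts := ![t])).trans Iff.rfl

end

section

/-- The polynomial with given coefficients. -/
noncomputable def Polynomial.ofCoeffs {R : Type*} [CommRing R] {m : ℕ} (a : Fin m → R) : R[X] :=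
  ∑ k : Fin m, C (a k) * X ^ (k : ℕ)

theorem Polynomial.eval_ofCoeffs {R : Type*} [CommRing R] {m : ℕ} (a : Fin m → R) (x : R) :
    (ofCoeffs a).eval x = ∑ k : Fin m, a k * x ^ (k : ℕ) := by
  simp [ofCoeffs, eval_finsetSum]

theorem Polynomial.eval_derivative_ofCoeffs {R : Type*} [CommRing R] {m : ℕ} (a : Fin m → R)
    (x : R) :
    (ofCoeffs a).derivative.eval x = ∑ k : Fin m, a k * ((k : ℕ) * x ^ ((k : ℕ) - 1)) := by
  simp [ofCoeffs, eval_finsetSum, derivative_X_pow]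

theorem Polynomial.coeff_ofCoeffs {R : Type*} [CommRing R] {m : ℕ} (a : Fin m → R) (k : ℕ) :
    (ofCoeffs a).coeff k = 0 ∨ ∃ l, (ofCoeffs a).coeff k = a l := by
  simp only [ofCoeffs, finsetSum_coeff, coeff_C_mul_X_pow]
  by_cases hk : k < m
  · right
    refine ⟨⟨k, hk⟩, ?_⟩
    rw [Finset.sum_eq_single ⟨k, hk⟩]
    · simp
    · intro b _ hb
      rw [if_neg]
      rintro rfl
      exact hb rfl
    · simp
  · left
    refine Finset.sum_eq_zero fun l _ => if_neg ?_
    have := l.2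
    omega

theorem Polynomial.ofCoeffs_coeff {R : Type*} [CommRing R] {m : ℕ} (p : R[X])
    (hm : p.natDegree < m) : ofCoeffs (fun k : Fin m => p.coeff k) = p := by
  rw [ofCoeffs, Fin.sum_univ_eq_sum_range (fun k => C (p.coeff k) * X ^ k) m]
  exact (p.as_sum_range_C_mul_X_pow' hm).symm

end

section

variable {F₁ : Type*} [Field F₁] {Γ₁ : Type*} [LinearOrderedCommGroupWithZero Γ₁]
variable {w₁ : Valuation F₁ Γ₁} {γ₁ : Γ₁}
variable {F₂ : Type*} [Field F₂] {Γ₂ : Type*} [LinearOrderedCommGroupWithZero Γ₂]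
variable {w₂ : Valuation F₂ Γ₂} {γ₂ : Γ₂}

theorem FirstOrder.Language.ElementarilyEquivalent.forall_realize {L : Language} {M N : Type*}
    [L.Structure M] [L.Structure N] (h : M ≅[L] N) {α : Type*} [Finite α] (φ : L.Formula α)
    (hM : ∀ v : α → M, φ.Realize v) (v : α → N) : φ.Realize v := by
  have := (h.realize_sentence (Formula.iAlls (α := Empty) α (φ.relabel Sum.inr))).1 (by
    simpa [Sentence.Realize, Formula.realize_iAlls, Formula.realize_relabel,
      Function.comp_def] using hM)
  simp only [Sentence.Realize, Formula.realize_iAlls, Formula.realize_relabel,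
      Function.comp_def, Sum.elim_inr] at this
  exact this v

/-- The property `LaurentLike` is elementary. -/
theorem LaurentLike.transfer (hA : LaurentLike w₁ γ₁)
    (h : letI : LVR.Structure F₁ := valuedStructure w₁ γ₁
      letI : LVR.Structure F₂ := valuedStructure w₂ γ₂
      F₁ ≅[LVR] F₂) : LaurentLike w₂ γ₂ := by
  let s₁ : LVR.Structure F₁ := valuedStructure w₁ γ₁
  let s₂ : LVR.Structure F₂ := valuedStructure w₂ γ₂
  have hunif : ∃ t, w₂ t = γ₂ := by
    have := h.forall_realize (α := Empty) (Language.Formula.iExs (Fin 1)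
      (LVR.unifFormula (.var (.inr 0)))) (by
        intro v
        obtain ⟨t, ht⟩ := hA.exists_unif
        simp only [Language.Formula.realize_iExs, LVR.realize_unifFormula]
        exact ⟨fun _ => t, ht⟩) Empty.elim
    simp only [Language.Formula.realize_iExs, LVR.realize_unifFormula] at this
    obtain ⟨t, ht⟩ := this
    exact ⟨t 0, ht⟩
  have hlt : ∀ t, w₂ t = γ₂ → w₂ t ≠ 0 ∧ w₂ t < 1 := by
    intro t ht
    have := h.forall_realize (α := Fin 1) (LVR.unifFormula (.var 0) ⟹
      (∼(LVR.leFormula (.var 0) (LVR.natTerm _ 0)) ⊓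
        ∼(LVR.leFormula (LVR.natTerm _ 1) (.var 0)))) (by
        intro v
        simp only [Language.Formula.realize_imp, Language.Formula.realize_inf,
          Language.Formula.realize_not, LVR.realize_unifFormula, LVR.realize_leFormula,
          LVR.realize_natTerm, Language.Term.realize_var]
        intro hv
        simp [hv, hA.ne_zero, hA.lt_one]) (fun _ => t)
    simp only [Language.Formula.realize_imp, Language.Formula.realize_inf,
          Language.Formula.realize_not, LVR.realize_unifFormula, LVR.realize_leFormula,
          LVR.realize_natTerm, Language.Term.realize_var] at this
    simpa using this ht
  constructor
  · intro n hn
    have := h.forall_realize (α := Empty) (LVR.leFormula (LVR.natTerm _ n) (LVR.natTerm _ 1) ⊓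
      LVR.leFormula (LVR.natTerm _ 1) (LVR.natTerm _ n)) (by
        intro v
        simp only [Language.Formula.realize_inf, LVR.realize_leFormula, LVR.realize_natTerm,
          Nat.cast_one, map_one, ← le_antisymm_iff, hA.nat n hn]) Empty.elim
    simpa only [s₂, Language.Formula.realize_inf, LVR.realize_leFormula, LVR.realize_natTerm,
          Nat.cast_one, map_one, ← le_antisymm_iff] using this
  · intro p hp x hx hpx hpx'
    have := h.forall_realize (α := Option (Fin (p.natDegree + 1)))
      (Language.Formula.iInf (fun k => LVR.leFormula (.var (some k)) (LVR.natTerm _ 1)) ⟹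
        LVR.leFormula (.var none) (LVR.natTerm _ 1) ⟹
        ∼(LVR.leFormula (LVR.natTerm _ 1) (LVR.sumTerm _ fun k =>
          LVR.mulTerm (.var (some k)) (LVR.powTerm (.var none) k))) ⟹
        LVR.leFormula (LVR.natTerm _ 1) (LVR.sumTerm _ fun k => LVR.mulTerm (.var (some k))
          (LVR.mulTerm (LVR.natTerm _ k) (LVR.powTerm (.var none) (k - 1)))) ⟹
        Language.Formula.iExs (Fin 1)
          (LVR.leFormula (LVR.sumTerm _ fun k => LVR.mulTerm (.var (.inl (some k)))
              (LVR.powTerm (LVR.addTerm (.var (.inr 0)) (.var (.inl none))) k))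
              (LVR.natTerm _ 0) ⊓
            ∼(LVR.leFormula (LVR.natTerm _ 1) (.var (.inr 0))))) (by
        intro v
        simp only [Language.Formula.realize_imp, Language.Formula.realize_inf,
          Language.Formula.realize_not, LVR.realize_leFormula, LVR.realize_mulTerm,
          LVR.realize_powTerm, Language.Formula.realize_iExs, LVR.realize_addTerm,
          LVR.realize_natTerm, Language.Term.realize_var, Language.Formula.realize_iInf,
          LVR.realize_sumTerm, ← Polynomial.eval_ofCoeffs (fun k => v (some k)),
          ← Polynomial.eval_derivative_ofCoeffs (fun k => v (some k)), Sum.elim_inl, Sum.elim_inr,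
          Nat.cast_one, Nat.cast_zero, map_one, map_zero, not_le, nonpos_iff_eq_zero,
          Valuation.zero_iff]
        intro h1 h2 h3 h4
        have hcoeff : ∀ k, w₁ ((ofCoeffs fun k => v (some k)).coeff k) ≤ 1 := by
          intro k
          rcases Polynomial.coeff_ofCoeffs (fun k => v (some k)) k with h | ⟨l, h⟩
          · simp [h]
          · rw [h]
            exact h1 l
        obtain ⟨r, hr, hr'⟩ := hA.hensel (ofCoeffs fun k => v (some k)) hcoeff (v none) h2 h3
          (le_antisymm (Valuation.eval_le_one (by
            intro k
            rw [coeff_derivative, map_mul, ← Nat.cast_succ, hA.nat _ k.succ_ne_zero, mul_one]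
            exact hcoeff _) h2) h4)
        exact ⟨fun _ => r - v none, by simpa using hr, hr'⟩)
      (fun o => o.elim x fun k => p.coeff k)
    simp only [Language.Formula.realize_imp, Language.Formula.realize_inf,
          Language.Formula.realize_not, LVR.realize_leFormula, LVR.realize_mulTerm,
          LVR.realize_powTerm, Language.Formula.realize_iExs, LVR.realize_addTerm,
          LVR.realize_natTerm, Language.Term.realize_var, Language.Formula.realize_iInf,
          LVR.realize_sumTerm, Option.elim_some, Option.elim_none,
          ← Polynomial.eval_ofCoeffs (fun k : Fin (p.natDegree + 1) => p.coeff k),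
          ← Polynomial.eval_derivative_ofCoeffs (fun k : Fin (p.natDegree + 1) => p.coeff k),
          ofCoeffs_coeff p (Nat.lt_succ_self _), Sum.elim_inl, Sum.elim_inr,
          Nat.cast_one, Nat.cast_zero, map_one, map_zero, not_le, nonpos_iff_eq_zero,
          Valuation.zero_iff] at this
    obtain ⟨r, hr, hr'⟩ := this (fun k => hp k) hx hpx hpx'.ge
    exact ⟨r 0 + x, hr, by simpa using hr'⟩
  · intro p hp hp0 hcoeff
    have := h.forall_realize (α := Fin p.natDegree)
      (Language.Formula.iInf (fun k => LVR.leFormula (.var k) (LVR.natTerm _ 1)) ⟹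
        Language.Formula.iExs (Fin 1) (LVR.leFormula (.var (.inr 0)) (LVR.natTerm _ 1) ⊓
          ∼(LVR.leFormula (LVR.natTerm _ 1) (LVR.addTerm
          (LVR.powTerm (.var (.inr 0)) p.natDegree) (LVR.sumTerm _ fun k =>
          LVR.mulTerm (.var (.inl k)) (LVR.powTerm (.var (.inr 0)) k)))))) (by
        intro v
        simp only [Language.Formula.realize_imp, Language.Formula.realize_inf,
          Language.Formula.realize_not, LVR.realize_leFormula, LVR.realize_mulTerm,
          LVR.realize_powTerm, Language.Formula.realize_iExs, LVR.realize_addTerm,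
          LVR.realize_natTerm, Language.Term.realize_var, Language.Formula.realize_iInf,
          LVR.realize_sumTerm, ← Polynomial.eval_ofCoeffs v, Sum.elim_inl, Sum.elim_inr,
          Nat.cast_one, map_one, not_le]
        intro h1
        have hdeg : (ofCoeffs v).degree < p.natDegree := by
          rw [ofCoeffs]
          refine (degree_sum_le _ _).trans_lt ?_
          rw [Finset.sup_lt_iff (WithBot.bot_lt_coe _)]
          intro k _
          exact (degree_C_mul_X_pow_le _ _).trans_lt (by exact_mod_cast k.2)
        have hdeg' : (X ^ p.natDegree + ofCoeffs v).natDegree = p.natDegree := by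
          rw [natDegree_add_eq_left_of_degree_lt (by simpa using hdeg), natDegree_X_pow]
        obtain ⟨x, hx, hx'⟩ := hA.resAlg (X ^ p.natDegree + ofCoeffs v)
          (monic_X_pow_add hdeg) (by rwa [hdeg']) (by
            intro k
            rw [coeff_add, coeff_X_pow]
            refine w₁.map_add_le ?_ ?_
            · split_ifs <;> simp
            · rcases Polynomial.coeff_ofCoeffs v k with h | ⟨l, h⟩
              · simp [h]
              · rw [h]
                exact h1 l)
        exact ⟨fun _ => x, hx, by simpa using hx'⟩) (fun k => p.coeff k)
    simp only [Language.Formula.realize_imp, Language.Formula.realize_inf,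
          Language.Formula.realize_not, LVR.realize_leFormula, LVR.realize_mulTerm,
          LVR.realize_powTerm, Language.Formula.realize_iExs, LVR.realize_addTerm,
          LVR.realize_natTerm, Language.Term.realize_var, Language.Formula.realize_iInf,
          LVR.realize_sumTerm, Sum.elim_inl, Sum.elim_inr,
          Nat.cast_one, map_one, not_le] at this
    obtain ⟨x, hx, hx'⟩ := this (fun k => hcoeff k)
    refine ⟨x 0, hx, ?_⟩
    rw [hp.as_sum]
    simpa [eval_finsetSum, Fin.sum_univ_eq_sum_range (fun k => p.coeff k * x 0 ^ k)] using hx'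
  · intro n hn x t ht
    have := h.forall_realize (α := Fin 2) (LVR.unifFormula (.var 1) ⟹
      Language.Formula.iExs (Fin 1) (Language.Formula.iSup fun j : Fin n =>
        LVR.leFormula (.var (.inl 0)) (LVR.mulTerm (LVR.powTerm (.var (.inl 1)) j)
          (LVR.powTerm (.var (.inr 0)) n)) ⊓
        LVR.leFormula (LVR.mulTerm (LVR.powTerm (.var (.inl 1)) j)
          (LVR.powTerm (.var (.inr 0)) n)) (.var (.inl 0)))) (by
        intro v
        simp only [Language.Formula.realize_imp, Language.Formula.realize_inf,
          LVR.realize_leFormula, LVR.realize_mulTerm, LVR.realize_unifFormula,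
          LVR.realize_powTerm, Language.Formula.realize_iExs,
          Language.Term.realize_var, Language.Formula.realize_iSup,
          Sum.elim_inl, Sum.elim_inr, ← le_antisymm_iff, map_mul, map_pow]
        intro hv
        obtain ⟨j, hj, z, hz⟩ := hA.zgrp n hn (v 0) (v 1) hv
        exact ⟨fun _ => z, ⟨j, hj⟩, hz⟩) ![x, t]
    simp only [Language.Formula.realize_imp, Language.Formula.realize_inf,
          LVR.realize_leFormula, LVR.realize_mulTerm, LVR.realize_unifFormula,
          LVR.realize_powTerm, Language.Formula.realize_iExs,
          Language.Term.realize_var, Language.Formula.realize_iSup,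
          Sum.elim_inl, Sum.elim_inr, ← le_antisymm_iff, map_mul, map_pow] at this
    obtain ⟨z, j, hz⟩ := this ht
    exact ⟨j, j.2, z 0, hz⟩
  · exact hunif
  · obtain ⟨t, ht⟩ := hunif
    rw [← ht]
    exact (hlt t ht).1
  · obtain ⟨t, ht⟩ := hunif
    rw [← ht]
    exact (hlt t ht).2
  · intro x hx
    obtain ⟨t, ht⟩ := hunif
    have := h.forall_realize (α := Fin 2) (LVR.unifFormula (.var 1) ⟹
      ∼(LVR.leFormula (LVR.natTerm _ 1) (.var 0)) ⟹ LVR.leFormula (.var 0) (.var 1)) (by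
        intro v
        simp only [Language.Formula.realize_imp, Language.Formula.realize_not,
          LVR.realize_leFormula, LVR.realize_unifFormula, Language.Term.realize_var,
          LVR.realize_natTerm, Nat.cast_one, map_one, not_le]
        intro h1 h2
        rw [h1]
        exact hA.le_of_lt_one _ h2) ![x, t]
    simp only [Language.Formula.realize_imp, Language.Formula.realize_not,
          LVR.realize_leFormula, LVR.realize_unifFormula, Language.Term.realize_var,
          LVR.realize_natTerm, Nat.cast_one, map_one, not_le] at this
    rw [← ht]
    exact this ht hx

end

section

/-- Newton's method in an adically complete ring, for polynomials that need not be monic. -/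
theorem IsAdicComplete.exists_isRoot {R : Type*} [CommRing R] (I : Ideal R) [IsAdicComplete I R]
    (f : R[X]) (a₀ : R) (h₁ : f.eval a₀ ∈ I)
    (h₂ : IsUnit (Ideal.Quotient.mk I (f.derivative.eval a₀))) :
    ∃ a, f.IsRoot a ∧ a - a₀ ∈ I := by
  let f' := derivative f
  -- we define a sequence `c n` by starting at `a₀` and then continually
  -- applying the function sending `b` to `b - f(b)/f'(b)` (Newton's method).
  -- Note that `f'.eval b` is a unit, because `b` has the same residue as `a₀` modulo `I`.
  let c : ℕ → R := fun n => Nat.recOn n a₀ fun _ b => b - f.eval b * Ring.inverse (f'.eval b)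
  have hc : ∀ n, c (n + 1) = c n - f.eval (c n) * Ring.inverse (f'.eval (c n)) := by
    intro n
    simp only [c]
  -- we now spend some time determining properties of the sequence `c : ℕ → R`
  -- `hc_mod`: for every `n`, we have `c n ≡ a₀ [SMOD I]`
  -- `hf'c`  : for every `n`, `f'.eval (c n)` is a unit
  -- `hfcI`  : for every `n`, `f.eval (c n)` is contained in `I ^ (n+1)`
  have hc_mod : ∀ n, c n ≡ a₀ [SMOD I] := by
    intro n
    induction n with
    | zero => rfl
    | succ n ih => ?_
    rw [hc, sub_eq_add_neg, ← add_zero a₀]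
    refine ih.add ?_
    rw [SModEq.zero, Ideal.neg_mem_iff]
    refine I.mul_mem_right _ ?_
    rw [← SModEq.zero] at h₁ ⊢
    exact (ih.eval f).trans h₁
  have hf'c : ∀ n, IsUnit (f'.eval (c n)) := by
    intro n
    have := isLocalHom_of_le_jacobson_bot I (IsAdicComplete.le_jacobson_bot I)
    apply IsUnit.of_map (Ideal.Quotient.mk I)
    convert! h₂ using 1
    exact SModEq.def.mp ((hc_mod n).eval _)
  have hfcI : ∀ n, f.eval (c n) ∈ I ^ (n + 1) := by
    intro n
    induction n with
    | zero => simpa only [Nat.rec_zero, zero_add, pow_one] using! h₁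
    | succ n ih => ?_
    rw [← taylor_eval_sub (c n), hc, sub_eq_add_neg, sub_eq_add_neg,
      add_neg_cancel_comm]
    rw [eval_eq_sum, sum_over_range' _ _ _ (lt_add_of_pos_right _ zero_lt_two), ←
      Finset.sum_range_add_sum_Ico _ (Nat.le_add_left _ _)]
    swap
    · intro i
      rw [zero_mul]
    refine Ideal.add_mem _ ?_ ?_
    · rw [← one_add_one_eq_two, Finset.sum_range_succ, Finset.range_one, Finset.sum_singleton,
        taylor_coeff_zero, taylor_coeff_one, pow_zero, pow_one, mul_one, mul_neg,
        mul_left_comm, Ring.mul_inverse_cancel _ (hf'c n), mul_one, add_neg_cancel]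
      exact Ideal.zero_mem _
    · refine Submodule.sum_mem _ ?_
      simp only [Finset.mem_Ico]
      rintro i ⟨h2i, _⟩
      have aux : n + 2 ≤ i * (n + 1) := by trans 2 * (n + 1) <;> nlinarith only [h2i]
      refine Ideal.mul_mem_left _ _ (Ideal.pow_le_pow_right aux ?_)
      rw [pow_mul']
      exact Ideal.pow_mem_pow ((Ideal.neg_mem_iff _).2 <| Ideal.mul_mem_right _ _ ih) _
  -- we are now in the position to show that `c : ℕ → R` is a Cauchy sequence
  have aux : ∀ m n, m ≤ n → c m ≡ c n [SMOD (I ^ m • ⊤ : Ideal R)] := by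
    intro m n hmn
    rw [← Ideal.one_eq_top, Ideal.smul_eq_mul, mul_one]
    obtain ⟨k, rfl⟩ := Nat.exists_eq_add_of_le hmn
    clear hmn
    induction k with
    | zero => rw [add_zero]
    | succ k ih => ?_
    rw [← add_assoc, hc, ← add_zero (c m), sub_eq_add_neg]
    refine ih.add ?_
    symm
    rw [SModEq.zero, Ideal.neg_mem_iff]
    refine Ideal.mul_mem_right _ _ (Ideal.pow_le_pow_right ?_ (hfcI _))
    rw [add_assoc]
    exact le_self_add
  -- hence the sequence converges to some limit point `a`, which is the `a` we are looking for
  obtain ⟨a, ha⟩ := IsPrecomplete.prec' c (aux _ _)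
  refine ⟨a, ?_, ?_⟩
  · show f.IsRoot a
    suffices ∀ n, f.eval a ≡ 0 [SMOD (I ^ n • ⊤ : Ideal R)] by exact IsHausdorff.haus' _ this
    intro n
    specialize ha n
    rw [← Ideal.one_eq_top, Ideal.smul_eq_mul, mul_one] at ha ⊢
    refine (ha.symm.eval f).trans ?_
    rw [SModEq.zero]
    exact Ideal.pow_le_pow_right le_self_add (hfcI _)
  · show a - a₀ ∈ I
    specialize ha (0 + 1)
    rw [hc, pow_one, ← Ideal.one_eq_top, Ideal.smul_eq_mul, mul_one, sub_eq_add_neg] at ha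
    rw [← SModEq.sub_mem, ← add_zero a₀]
    refine ha.symm.trans (SModEq.rfl.add ?_)
    rw [SModEq.zero, Ideal.neg_mem_iff]
    exact Ideal.mul_mem_right _ _ h₁

theorem LaurentSeries.val_coe_lt_one_iff (F : PowerSeries ℂ) :
    (Valued.v : Valuation (LaurentSeries ℂ) (WithZero (Multiplicative ℤ)))
      (HahnSeries.ofPowerSeries ℤ ℂ F) < 1 ↔ PowerSeries.constantCoeff F = 0 := by
  have h := LaurentSeries.intValuation_le_iff_coeff_lt_eq_zero ℂ (d := 1) F
  have h' (g : WithZero (Multiplicative ℤ)) : g < 1 ↔ g ≤ WithZero.exp (-((1 : ℕ) : ℤ)) := by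
    induction g using WithZero.expRecOn with
    | zero => simp
    | exp m =>
      rw [← WithZero.exp_zero, WithZero.exp_lt_exp, WithZero.exp_le_exp]
      push_cast
      lia
  rw [h']
  refine h.trans ⟨fun h ↦ by simpa using h 0 one_pos, fun h n hn ↦ ?_⟩
  obtain rfl : n = 0 := by lia
  simpa using h

theorem LaurentSeries.val_le_one_iff_exists (f : LaurentSeries ℂ) :
    (Valued.v : Valuation (LaurentSeries ℂ) (WithZero (Multiplicative ℤ))) f ≤ 1 ↔
      ∃ F, HahnSeries.ofPowerSeries ℤ ℂ F = f :=
  LaurentSeries.val_le_one_iff_eq_coe ℂ f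

theorem LaurentSeries.val_eq_one_iff (F : PowerSeries ℂ) :
    (Valued.v : Valuation (LaurentSeries ℂ) (WithZero (Multiplicative ℤ)))
      (HahnSeries.ofPowerSeries ℤ ℂ F) = 1 ↔ PowerSeries.constantCoeff F ≠ 0 := by
  have h := (LaurentSeries.val_le_one_iff_exists (HahnSeries.ofPowerSeries ℤ ℂ F)).2 ⟨F, rfl⟩
  rw [← not_iff_not, not_not, ← LaurentSeries.val_coe_lt_one_iff]
  exact ⟨fun h' ↦ lt_of_le_of_ne h h', fun h' ↦ h'.ne⟩

theorem LaurentSeries.exists_polynomial_map_eq (p : (LaurentSeries ℂ)[X])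
    (hp : ∀ k, (Valued.v : Valuation (LaurentSeries ℂ) (WithZero (Multiplicative ℤ)))
      (p.coeff k) ≤ 1) :
    ∃ P : (PowerSeries ℂ)[X], P.map (HahnSeries.ofPowerSeries ℤ ℂ) = p := by
  rw [← mem_lifts, lifts_iff_coeff_lifts]
  intro n
  exact (LaurentSeries.val_le_one_iff_exists _).1 (hp n)

theorem LaurentSeries.val_unif :
    (Valued.v : Valuation (LaurentSeries ℂ) (WithZero (Multiplicative ℤ)))
      (HahnSeries.single (1 : ℤ) (1 : ℂ)) = WithZero.exp (-1 : ℤ) :=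
  LaurentSeries.valuation_single_zpow ℂ 1

theorem LaurentSeries.laurentLike :
    LaurentLike (Valued.v : Valuation (LaurentSeries ℂ) (WithZero (Multiplicative ℤ)))
      (WithZero.exp (-1 : ℤ)) where
  nat n hn := by
    rw [← map_natCast (HahnSeries.ofPowerSeries ℤ ℂ), LaurentSeries.val_eq_one_iff, map_natCast]
    exact_mod_cast hn
  hensel p hp x hx h h' := by
    obtain ⟨P, rfl⟩ := LaurentSeries.exists_polynomial_map_eq p hp
    obtain ⟨x, rfl⟩ := (LaurentSeries.val_le_one_iff_exists x).1 hx
    rw [eval_map, eval₂_at_apply, LaurentSeries.val_coe_lt_one_iff] at h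
    rw [derivative_map, eval_map, eval₂_at_apply, LaurentSeries.val_eq_one_iff] at h'
    obtain ⟨r, hr, hrx⟩ := IsAdicComplete.exists_isRoot (Ideal.span {(PowerSeries.X : PowerSeries ℂ)})
      P x (by rwa [Ideal.mem_span_singleton, PowerSeries.X_dvd_iff])
      ((PowerSeries.isUnit_iff_constantCoeff.2 h'.isUnit).map _)
    refine ⟨HahnSeries.ofPowerSeries ℤ ℂ r, ?_, ?_⟩
    · rw [eval_map, eval₂_at_apply, hr, map_zero]
    · rwa [← map_sub, LaurentSeries.val_coe_lt_one_iff, ← PowerSeries.X_dvd_iff,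
        ← Ideal.mem_span_singleton]
  resAlg p hp hn hc := by
    obtain ⟨P, rfl⟩ := LaurentSeries.exists_polynomial_map_eq p hc
    have hinj : Function.Injective (HahnSeries.ofPowerSeries ℤ ℂ) :=
      HahnSeries.ofPowerSeries_injective
    rw [natDegree_map_eq_of_injective hinj] at hn
    have hP : P.Monic := monic_of_injective hinj hp
    obtain ⟨z, hz⟩ := IsAlgClosed.exists_root (P.map PowerSeries.constantCoeff) (by
      refine degree_ne_of_natDegree_ne ?_
      rwa [hP.natDegree_map])
    refine ⟨HahnSeries.ofPowerSeries ℤ ℂ (PowerSeries.C z),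
      (LaurentSeries.val_le_one_iff_exists _).2 ⟨_, rfl⟩, ?_⟩
    rw [eval_map, eval₂_at_apply, LaurentSeries.val_coe_lt_one_iff]
    rw [IsRoot, eval_map] at hz
    rw [← eval₂_at_apply, PowerSeries.constantCoeff_C]
    exact hz
  zgrp n hn x t ht := by
    rcases eq_or_ne x 0 with rfl | hx
    · exact ⟨0, hn.bot_lt, 0, by simp [hn]⟩
    have hx' := (Valuation.ne_zero_iff
      (Valued.v : Valuation (LaurentSeries ℂ) (WithZero (Multiplicative ℤ)))).2 hx
    rw [ht]
    obtain ⟨m, hm⟩ : ∃ m : ℤ, (Valued.v : Valuation (LaurentSeries ℂ)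
      (WithZero (Multiplicative ℤ))) x = WithZero.exp (-m) :=
      ⟨-WithZero.log (Valued.v x), by rw [neg_neg, WithZero.exp_log hx']⟩
    have hn' : (0 : ℤ) < n := by lia
    refine ⟨(m % n).toNat, ?_, HahnSeries.single (m / n) 1, ?_⟩
    · have := Int.emod_lt_of_pos m hn'
      have := Int.emod_nonneg m hn'.ne'
      lia
    · rw [hm, LaurentSeries.valuation_single_zpow, ← WithZero.exp_nsmul, ← WithZero.exp_nsmul,
        ← WithZero.exp_add]
      congr 1
      have := Int.emod_add_mul_ediv m n
      rw [nsmul_eq_mul, nsmul_eq_mul, Int.toNat_of_nonneg (Int.emod_nonneg m hn'.ne')]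
      linarith
  exists_unif := ⟨_, LaurentSeries.val_unif⟩
  ne_zero := WithZero.exp_ne_zero
  lt_one := by
    rw [← WithZero.exp_zero, WithZero.exp_lt_exp]
    lia
  le_of_lt_one x hx := by
    generalize (Valued.v : Valuation (LaurentSeries ℂ) (WithZero (Multiplicative ℤ))) x = g at hx ⊢
    induction g using WithZero.expRecOn with
    | zero => simp
    | exp m =>
      rw [← WithZero.exp_zero, WithZero.exp_lt_exp] at hx
      rw [WithZero.exp_le_exp]
      lia

end

section

variable {K : Type*} [Field K] {Γ₀ : Type*} [LinearOrderedCommGroupWithZero Γ₀]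
  {ι : Type*} (u : Ultrafilter ι)

noncomputable instance Filter.Germ.instLinearOrderedCommGroupWithZero :
    LinearOrderedCommGroupWithZero (Germ (u : Filter ι) Γ₀) where
  __ := (inferInstance : LinearOrder (Germ (u : Filter ι) Γ₀))
  __ := (inferInstance : CommMonoid (Germ (u : Filter ι) Γ₀))
  __ := (inferInstance : GroupWithZero (Germ (u : Filter ι) Γ₀))
  bot := 0
  bot_le x := Germ.inductionOn x fun _ ↦ Germ.coe_le.2 <| Eventually.of_forall fun _ ↦ zero_le
  isBot_zero x := Germ.inductionOn x fun _ ↦ Germ.coe_le.2 <| Eventually.of_forall fun _ ↦ zero_le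
  mul_lt_mul_of_pos_left x := Germ.inductionOn x fun _ hf y z ↦ Germ.inductionOn₂ y z fun _ _ h ↦
    Germ.coe_lt.2 <| (Germ.coe_lt.1 hf).mp <| (Germ.coe_lt.1 h).mono fun _ h h' ↦
      mul_lt_mul_of_pos_left h h'

/-- The valuation on an ultrapower of a valued field. -/
noncomputable def Valuation.germ (v : Valuation K Γ₀) :
    Valuation (Germ (u : Filter ι) K) (Germ (u : Filter ι) Γ₀) where
  toFun := Germ.map v
  map_zero' := congrArg _ (funext fun _ ↦ map_zero v)
  map_one' := congrArg _ (funext fun _ ↦ map_one v)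
  map_mul' x y := Germ.inductionOn₂ x y fun _ _ ↦ congrArg _ (funext fun _ ↦ map_mul v _ _)
  map_add_le_max' x y := Germ.inductionOn₂ x y fun _ _ ↦ by
    refine le_of_le_of_eq ?_ (Germ.max_def _ _).symm
    exact Germ.coe_le.2 <| Eventually.of_forall fun _ ↦ v.map_add _ _

variable (v : Valuation K Γ₀)

theorem isPowVal_germ_iff (m : ℕ) (x : ι → K) :
    IsPowVal (v.germ u) m (x : Germ (u : Filter ι) K) ↔ ∀ᶠ n in u, IsPowVal v m (x n) := by
  constructor
  · rintro ⟨z, hz⟩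
    induction z using Germ.inductionOn with | _ z
    exact (Germ.coe_eq.1 hz).mono fun n hn ↦ ⟨z n, hn⟩
  · intro h
    obtain ⟨z, hz⟩ := h.choice
    exact ⟨(z : Germ (u : Filter ι) K), Germ.coe_eq.2 hz⟩

/-- A basic condition in an ultrapower is given by a family of subsets of the factors. -/
theorem BasicCondition.exists_family {Q : Germ (u : Filter ι) K → Prop}
    (hQ : BasicCondition (v.germ u) Q) :
    ∃ q : ι → K → Prop, ∀ z : ι → K, Q (z : Germ (u : Filter ι) K) ↔ ∀ᶠ n in u, q n (z n) := by
  cases hQ with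
  | near b c =>
    induction b, c using Germ.inductionOn₂ with | _ b c
    exact ⟨fun n z ↦ v (z - b n) = v (c n), fun z ↦ Germ.coe_eq⟩
  | lt e =>
    induction e using Germ.inductionOn with | _ e
    exact ⟨fun n z ↦ v z < v (e n), fun z ↦ Germ.coe_lt⟩
  | gt e =>
    induction e using Germ.inductionOn with | _ e
    exact ⟨fun n z ↦ v (e n) < v z, fun z ↦ Germ.coe_lt⟩
  | pow e m n =>
    induction e using Germ.inductionOn with | _ e
    exact ⟨fun i z ↦ IsPowVal v n (e i * z ^ m), fun z ↦ isPowVal_germ_iff u v n _⟩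
  | not_pow e m n =>
    induction e using Germ.inductionOn with | _ e
    exact ⟨fun i z ↦ ¬ IsPowVal v n (e i * z ^ m), fun z ↦
      (not_congr (isPowVal_germ_iff u v n _)).trans Ultrafilter.eventually_not.symm⟩

theorem exists_forall_of_exists_forall_le {α : Type*} [Nonempty α] (q : ℕ → α → Prop) (N : ℕ) :
    ∃ y, ∀ J ≤ N, (∃ y, ∀ k ≤ J, q k y) → ∀ k ≤ J, q k y := by
  induction N with
  | zero =>
    by_cases h : ∃ y, ∀ k ≤ 0, q k y
    · obtain ⟨y, hy⟩ := h
      exact ⟨y, fun J hJ _ k hk ↦ hy k (hk.trans hJ)⟩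
    · refine ⟨Classical.arbitrary α, fun J hJ h' ↦ ?_⟩
      obtain rfl : J = 0 := by lia
      exact absurd h' h
  | succ N ih =>
    by_cases h : ∃ y, ∀ k ≤ N + 1, q k y
    · obtain ⟨y, hy⟩ := h
      exact ⟨y, fun J hJ _ k hk ↦ hy k (hk.trans hJ)⟩
    · obtain ⟨y, hy⟩ := ih
      refine ⟨y, fun J hJ h' ↦ ?_⟩
      rcases hJ.lt_or_eq with hJ | rfl
      · exact hy J (by lia) h'
      · exact absurd h' h

theorem isBasicSaturated_germ : IsBasicSaturated (v.germ (hyperfilter ℕ)) := by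
  intro Q hQ hfin
  choose q hq using fun k ↦ (hQ k).exists_family
  choose z hz using fun n ↦ exists_forall_of_exists_forall_le (fun k ↦ q k n) n
  refine ⟨(z : Germ (hyperfilter ℕ : Filter ℕ) K), fun k ↦ (hq k z).2 ?_⟩
  have hk : ∀ᶠ n in (hyperfilter ℕ : Filter ℕ), k ≤ n :=
    (eventually_ge_atTop k).filter_mono Nat.hyperfilter_le_atTop
  obtain ⟨y, hy⟩ := hfin k
  induction y using Germ.inductionOn with | _ y
  have hy' : ∀ᶠ n in (hyperfilter ℕ : Filter ℕ), ∀ i ∈ Set.Iic k, q i n (y n) :=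
    (eventually_all_finite (Set.finite_Iic k)).2 fun i hi ↦ (hq i y).1 (hy i hi)
  filter_upwards [hk, hy'] with n hn hn'
  exact hz n k hn ⟨y n, hn'⟩ k le_rfl

/-- The `LVR`-structure on the ultrapower agrees with that of the ultrapower valuation. -/
theorem valuedStructure_germ (γ : Γ₀) :
    valuedStructure (v.germ u) ((γ : Γ₀) : Germ (u : Filter ι) Γ₀) =
      @FirstOrder.Language.Ultraproduct.structure ι (fun _ ↦ K) u LVR
        (fun _ ↦ valuedStructure v γ) := by
  let _ : LVR.Structure K := valuedStructure v γ
  refine Language.Structure.ext ?_ ?_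
  · funext n f x
    obtain ⟨y, rfl⟩ : ∃ y : Fin n → ι → K, x = fun i ↦ (y i : Germ (u : Filter ι) K) := by
      choose y hy using fun i ↦ Quotient.exists_rep (x i)
      exact ⟨y, funext fun i ↦ (hy i).symm⟩
    refine Eq.trans ?_ (Language.Ultraproduct.funMap_cast (L := LVR) (M := fun _ ↦ K) f y).symm
    cases f <;> rfl
  · funext n r x
    obtain ⟨y, rfl⟩ : ∃ y : Fin n → ι → K, x = fun i ↦ (y i : Germ (u : Filter ι) K) := by
      choose y hy using fun i ↦ Quotient.exists_rep (x i)
      exact ⟨y, funext fun i ↦ (hy i).symm⟩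
    refine propext (Iff.trans ?_ (Language.relMap_quotient_mk' (L := LVR)
      (s := (u : Filter ι).productSetoid fun _ ↦ K) r y).symm)
    cases r with
    | dvd => exact Germ.coe_le
    | N => exact Germ.coe_eq
    | pow m =>
      constructor
      · rintro ⟨z, hz⟩
        induction z using Germ.inductionOn with | _ z
        exact (Germ.coe_eq.1 hz).mono fun n hn ↦ ⟨z n, hn⟩
      · intro h
        obtain ⟨z, hz⟩ := Eventually.choice h
        exact ⟨(z : Germ (u : Filter ι) K), Germ.coe_eq.2 hz⟩

theorem realize_germ_iff (γ : Γ₀) {β : Type*} (φ : LVR.Formula β) (x : β → ι → K) :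
    (letI := valuedStructure (v.germ u) ((γ : Γ₀) : Germ (u : Filter ι) Γ₀)
     φ.Realize fun i ↦ (x i : Germ (u : Filter ι) K)) ↔
    ∀ᶠ n in u, (letI := valuedStructure v γ
                φ.Realize fun i ↦ x i n) := by
  rw [valuedStructure_germ]
  let _ : LVR.Structure K := valuedStructure v γ
  exact Language.Ultraproduct.realize_formula_cast (L := LVR) (M := fun _ ↦ K) φ x

theorem elementarilyEquivalent_germ (γ : Γ₀) :
    letI := valuedStructure (v.germ u) ((γ : Γ₀) : Germ (u : Filter ι) Γ₀)
    letI := valuedStructure v γ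
    K ≅[LVR] Germ (u : Filter ι) K := by
  rw [valuedStructure_germ]
  let _ : LVR.Structure K := valuedStructure v γ
  let _ : LVR.Structure (Germ (u : Filter ι) K) :=
    Language.Ultraproduct.structure (M := fun _ ↦ K)
  refine Language.elementarilyEquivalent_iff.2 fun φ ↦ ?_
  refine Iff.trans ?_ (Language.Ultraproduct.sentence_realize (L := LVR) (M := fun _ ↦ K)
    (u := u) φ).symm
  exact eventually_const.symm

end

section

variable {K : Type*} [Field K] {Γ₀ : Type*} [LinearOrderedCommGroupWithZero Γ₀]

theorem Valuation.eq_one_iff_residue_ne_zero (v : Valuation K Γ₀) (a : v.valuationSubring) :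
    v (a : K) = 1 ↔ IsLocalRing.residue v.valuationSubring a ≠ 0 := by
  have hv : v.Integers v.valuationSubring :=
    ⟨Subtype.val_injective, fun x ↦ x.2, fun _ h ↦ ⟨⟨_, h⟩, rfl⟩⟩
  rw [IsLocalRing.residue_ne_zero_iff_isUnit, hv.isUnit_iff_valuation_eq_one]
  rfl

/-- A primitive polynomial over the valuation ring has value one at almost all terms of a sequence
with pairwise distinct residues. -/
theorem Valuation.eventually_eval_eq_one (v : Valuation K Γ₀) {p : K[X]}
    (hp : ∀ k, v (p.coeff k) ≤ 1) {m : ℕ} (hm : v (p.coeff m) = 1) {x : ℕ → v.valuationSubring}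
    (hx : Function.Injective fun n ↦ IsLocalRing.residue v.valuationSubring (x n)) :
    ∀ᶠ n in cofinite, v (p.eval (x n : K)) = 1 := by
  classical
  obtain ⟨P, rfl⟩ : ∃ P : v.valuationSubring[X], P.map v.valuationSubring.subtype = p := by
    rw [← mem_lifts, lifts_iff_coeff_lifts]
    exact fun n ↦ ⟨⟨_, hp n⟩, rfl⟩
  have hP : P.map (IsLocalRing.residue v.valuationSubring) ≠ 0 := by
    intro h
    rw [coeff_map] at hm
    refine (v.eq_one_iff_residue_ne_zero _).1 hm ?_
    rw [← coeff_map, h, coeff_zero]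
  refine Set.Finite.subset (((P.map (IsLocalRing.residue v.valuationSubring)).roots.toFinset
    |>.finite_toSet).preimage hx.injOn) fun n hn ↦ ?_
  rw [Set.mem_preimage, Finset.mem_coe, Multiset.mem_toFinset, mem_roots hP, IsRoot,
    eval_map, eval₂_at_apply]
  by_contra h
  refine hn ?_
  have := (v.eq_one_iff_residue_ne_zero _).2 h
  rwa [← ValuationSubring.subtype_apply, ← eval₂_at_apply, ← eval_map] at this

variable (K) in
/-- The diagonal embedding of a field into its ultrapower. -/
noncomputable def constEmb : K →+* Germ (hyperfilter ℕ : Filter ℕ) K :=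
  (Germ.coeRingHom _).comp (Pi.constRingHom ℕ K)

theorem eval₂_constEmb (p : K[X]) (x : ℕ → K) :
    p.eval₂ (constEmb K) (x : Germ (hyperfilter ℕ : Filter ℕ) K) =
      ((fun n ↦ p.eval (x n) : ℕ → K) : Germ (hyperfilter ℕ : Filter ℕ) K) := by
  have h : (fun n ↦ p.eval (x n) : ℕ → K) = p.eval₂ (Pi.constRingHom ℕ K) x := by
    funext n
    rw [← Pi.evalRingHom_apply (fun _ : ℕ ↦ K) n (eval₂ _ _ _), hom_eval₂]
    rfl
  rw [h]
  exact (hom_eval₂ p (Pi.constRingHom ℕ K) (Germ.coeRingHom (hyperfilter ℕ : Filter ℕ)) x).symm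

theorem Valuation.exists_germ_eval₂_eq (v : Valuation K Γ₀) (A : Subfield K) (g : A[X]) :
    ∃ c : A, ∀ x : ℕ → v.valuationSubring,
      Function.Injective (fun n ↦ IsLocalRing.residue v.valuationSubring (x n)) →
      v.germ (hyperfilter ℕ) (g.eval₂ ((constEmb K).comp A.subtype) ((fun n ↦ (x n : K) : ℕ → K) :
        Germ (hyperfilter ℕ : Filter ℕ) K)) =
      v.germ (hyperfilter ℕ) ((constEmb K).comp A.subtype c) := by
  obtain ⟨k, hk⟩ := exists_coeff_max (v.comap A.subtype) g
  refine ⟨g.coeff k, fun x hx ↦ ?_⟩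
  rw [← eval₂_map, eval₂_constEmb]
  refine Germ.coe_eq.2 (Eventually.filter_mono hyperfilter_le_cofinite ?_)
  rcases eq_or_ne (g.coeff k) 0 with h0 | h0
  · have hg : g = 0 := by
      ext l
      have := hk l
      rw [h0] at this
      simpa using this
    exact Eventually.of_forall fun n ↦ by simp [hg]
  have h0' : v (g.coeff k : K) ≠ 0 := (Valuation.ne_zero_iff _).2 (by simpa using h0)
  have h := v.eventually_eval_eq_one (p := C (g.coeff k : K)⁻¹ * g.map A.subtype) (m := k)
    (fun l ↦ by
      rw [coeff_C_mul, coeff_map, map_mul, map_inv₀]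
      exact inv_mul_le_one_of_le₀ (hk l) zero_le)
    (by
      rw [coeff_C_mul, coeff_map, map_mul, map_inv₀]
      exact inv_mul_cancel₀ h0') hx
  filter_upwards [h] with n hn
  rw [eval_C_mul, map_mul, map_inv₀, inv_mul_eq_one₀ h0'] at hn
  exact hn.symm

theorem Subfield.countable_closure {s : Set K} (hs : s.Countable) :
    Countable (Subfield.closure s) := by
  rw [← Cardinal.mk_le_aleph0_iff]
  refine (Subfield.cardinalMk_closure_le_max s).trans (max_le ?_ le_rfl)
  exact Cardinal.mk_le_aleph0_iff.2 hs.to_subtype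

end

section

variable {K : Type*} [Field K] {Γ₀ : Type*} [LinearOrderedCommGroupWithZero Γ₀]

theorem LaurentLike.residue_natCast_injective {v : Valuation K Γ₀} {γ : Γ₀}
    (hA : LaurentLike v γ) : Function.Injective fun n : ℕ ↦
      IsLocalRing.residue v.valuationSubring (n : v.valuationSubring) := by
  have : CharZero (IsLocalRing.ResidueField v.valuationSubring) := by
    refine charZero_of_inj_zero fun n hn ↦ ?_
    by_contra h
    refine (v.eq_one_iff_residue_ne_zero (n : v.valuationSubring)).1 ?_ (by rw [map_natCast, hn])
    exact_mod_cast hA.nat n h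
  intro m n h
  simpa using h

theorem natCast_mem_substructure (v : Valuation K Γ₀) (γ : Γ₀)
    (S : letI := valuedStructure v γ; LVR.Substructure K) (n : ℕ) : (n : K) ∈ S := by
  let _ := valuedStructure v γ
  induction n with
  | zero =>
    have := S.fun_mem (LVRFunc.zero : LVR.Functions 0) Fin.elim0 fun i ↦ i.elim0
    rwa [Nat.cast_zero]
  | succ n ih =>
    have h1 : (1 : K) ∈ S := S.fun_mem (LVRFunc.one : LVR.Functions 0) Fin.elim0 fun i ↦ i.elim0
    have := S.fun_mem (LVRFunc.add : LVR.Functions 2) ![(n : K), 1] (by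
      intro i
      fin_cases i
      exacts [ih, h1])
    rwa [Nat.cast_succ]

/-- A formula over finitely many parameters cannot distinguish, in the ultrapower, two sequences
with pairwise distinct residues. -/
theorem LaurentLike.eventually_realize_iff {v : Valuation K Γ₀} {γ : Γ₀} (hA : LaurentLike v γ)
    (P : Finset K) (φ : LVR.Formula (P ⊕ Fin 1)) (x y : ℕ → v.valuationSubring)
    (hx : Function.Injective fun n ↦ IsLocalRing.residue v.valuationSubring (x n))
    (hy : Function.Injective fun n ↦ IsLocalRing.residue v.valuationSubring (y n)) :
    letI := valuedStructure v γ
    (∀ᶠ n in (hyperfilter ℕ : Filter ℕ), φ.Realize (Sum.elim (↑) fun _ ↦ (x n : K))) ↔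
      ∀ᶠ n in (hyperfilter ℕ : Filter ℕ), φ.Realize (Sum.elim (↑) fun _ ↦ (y n : K)) := by
  obtain ⟨t, ht⟩ := hA.exists_unif
  let A : Subfield K := Subfield.closure (insert t (P : Set K))
  have : Countable A := Subfield.countable_closure (P.countable_toSet.insert t)
  have hPA (a : P) : (a : K) ∈ A := Subfield.subset_closure (Set.mem_insert_of_mem _ a.2)
  have htA : t ∈ A := Subfield.subset_closure (Set.mem_insert _ _)
  let i : A →+* Germ (hyperfilter ℕ : Filter ℕ) K := (constEmb K).comp A.subtype
  have hA' : LaurentLike (v.germ (hyperfilter ℕ)) ((γ : Γ₀) : Germ (hyperfilter ℕ : Filter ℕ) Γ₀) :=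
    hA.transfer (elementarilyEquivalent_germ (hyperfilter ℕ) v γ)
  have hS : SameVal (v.germ (hyperfilter ℕ)) ((γ : Γ₀) : Germ (hyperfilter ℕ : Filter ℕ) Γ₀) i i :=
    ⟨fun _ _ ↦ Iff.rfl, fun _ _ _ ↦ Iff.rfl, ⟨t, htA⟩, by
      have : v.germ (hyperfilter ℕ) (i ⟨t, htA⟩) =
          ((γ : Γ₀) : Germ (hyperfilter ℕ : Filter ℕ) Γ₀) := by
        rw [← ht]
        rfl
      exact ⟨this, this⟩⟩
  let x' : Germ (hyperfilter ℕ : Filter ℕ) K := (fun n ↦ (x n : K) : ℕ → K)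
  let y' : Germ (hyperfilter ℕ : Filter ℕ) K := (fun n ↦ (y n : K) : ℕ → K)
  have hC : Compat (v.germ (hyperfilter ℕ)) i i x' y' := Compat.of_eq hS fun g ↦ by
    obtain ⟨c, hc⟩ := v.exists_germ_eval₂_eq A g
    exact ⟨c, hc x hx, hc y hy⟩
  obtain ⟨G, hG, hi, hxy, -⟩ := hC.exists_partialIso hS
  let p : P ⊕ Fin 1 → Germ (hyperfilter ℕ : Filter ℕ) K × Germ (hyperfilter ℕ : Filter ℕ) K :=
    Sum.elim (fun a ↦ (i ⟨a, hPA a⟩, i ⟨a, hPA a⟩)) fun _ ↦ (x', y')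
  have key := hG.realize_iff hA' (isBasicSaturated_germ v) φ p
    (by rintro (a | a); exacts [hi _, hxy]) Fin.elim0 (fun a ↦ a.elim0)
  have hr (z : ℕ → v.valuationSubring) (q : P ⊕ Fin 1 → Germ (hyperfilter ℕ : Filter ℕ) K)
      (hq : ∀ a, q (.inl a) = ((a : K) : Germ (hyperfilter ℕ : Filter ℕ) K))
      (hq' : ∀ a, q (.inr a) = ((fun n ↦ (z n : K) : ℕ → K) : Germ (hyperfilter ℕ : Filter ℕ) K))
      (e : Fin 0 → Germ (hyperfilter ℕ : Filter ℕ) K) :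
      letI := valuedStructure v γ
      letI := valuedStructure (v.germ (hyperfilter ℕ))
        ((γ : Γ₀) : Germ (hyperfilter ℕ : Filter ℕ) Γ₀)
      Language.BoundedFormula.Realize φ q e ↔
        ∀ᶠ n in (hyperfilter ℕ : Filter ℕ), φ.Realize (Sum.elim (↑) fun _ ↦ (z n : K)) := by
    have h := realize_germ_iff (hyperfilter ℕ) v γ φ
      (Sum.elim (fun a _ ↦ (a : K)) fun _ n ↦ (z n : K))
    have hq'' : q = fun a ↦ ((Sum.elim (fun (a : P) _ ↦ (a : K)) (fun (_ : Fin 1) n ↦ (z n : K)) a :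
        ℕ → K) : Germ (hyperfilter ℕ : Filter ℕ) K) := by
      funext a
      rcases a with a | a
      exacts [hq a, hq' a]
    have he : e = default := Subsingleton.elim _ _
    rw [hq'', he]
    refine h.trans (eventually_congr (Eventually.of_forall fun n ↦ ?_))
    rw [show (fun a ↦ Sum.elim (fun (a : P) _ ↦ (a : K)) (fun (_ : Fin 1) n ↦ (z n : K)) a n) =
      Sum.elim (↑) fun _ ↦ (z n : K) from funext fun a ↦ by rcases a with a | a <;> rfl]
  exact ((hr x _ (fun _ ↦ rfl) (fun _ ↦ rfl) _).symm.trans key).trans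
    (hr y _ (fun _ ↦ rfl) (fun _ ↦ rfl) _)

end

/-- Let `K` be a valued field whose value group has a least positive
element, regarded as an `L_VR`-structure, elementarily equivalent to `ℂ((t))`.
Let `X ⊆ O_K` be definable with parameters from `K` such that `res(X)` is
infinite (`X` is res-cofinite), and let `K₀` be an elementary `L_VR`-substructure
of `K`.  Then `X ∩ K₀ ≠ ∅`. -/
theorem stmt_9 {K : Type*} [Field K] {Γ₀ : Type*} [LinearOrderedCommGroupWithZero Γ₀]
    (v : Valuation K Γ₀) (hsurj : Function.Surjective v)
    (γ₁ : Γ₀) (hγ₁ : IsLeastPos γ₁) :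
    letI : LVR.Structure K := valuedStructure v γ₁
    letI : LVR.Structure (LaurentSeries ℂ) := laurentStructure
    ∀ (_ : K ≅[LVR] LaurentSeries ℂ)
      (X : Set K) (_ : ∀ x ∈ X, x ∈ v.valuationSubring)
      (_ : Set.Definable₁ (Set.univ : Set K) LVR X)
      (_ : {u | ∃ a : v.valuationSubring, (a : K) ∈ X ∧
              IsLocalRing.residue v.valuationSubring a = u}.Infinite)
      (S : LVR.Substructure K) (_ : S.IsElementary),
      ∃ a : K, a ∈ X ∧ a ∈ S := by
  intro hKL X hXO hX hinf S _
  let _ : LVR.Structure K := valuedStructure v γ₁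
  let _ : LVR.Structure (LaurentSeries ℂ) := laurentStructure
  have hA : LaurentLike v γ₁ := LaurentSeries.laurentLike.transfer hKL.symm
  by_contra! hXS
  obtain ⟨P, -, hP⟩ := Set.definable_iff_finitely_definable.1 hX
  obtain ⟨φ, hφ⟩ := Set.definable_iff_exists_formula_sum.1 hP
  have hφX (a : K) : a ∈ X ↔ φ.Realize (Sum.elim (↑) fun _ ↦ a) := Set.ext_iff.1 hφ fun _ ↦ a
  have hx : ∀ n, ∃ a : v.valuationSubring, (a : K) ∈ X ∧
      IsLocalRing.residue v.valuationSubring a = Set.Infinite.natEmbedding _ hinf n :=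
    fun n ↦ (Set.Infinite.natEmbedding _ hinf n).2
  choose x hxX hx using hx
  have h := (hA.eventually_realize_iff P φ x (fun n ↦ (n : v.valuationSubring)) (by
    intro m n h
    simp only [hx] at h
    exact (Set.Infinite.natEmbedding _ hinf).injective (Subtype.ext h)) hA.residue_natCast_injective).1
    (Eventually.of_forall fun n ↦ (hφX _).1 (hxX n))
  obtain ⟨n, hn⟩ := h.exists
  exact hXS _ ((hφX _).2 hn) (by exact_mod_cast natCast_mem_substructure v γ₁ S n)
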